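/- arXiv:1210.2083 — 2 statements merged into one kernel-verified Lean document; each statement's English description precedes it below -/
import Mathlib

section
/- Let A(x) ∈ M_{L×1}(ℤ[x]) (a column vector of integer polynomials) have degree at most D and satisfy: (a) its non-constant part A_*(x) is not identically zero, and (b) for all v ∈ ℚ^L and w ∈ ℚ, if v·A_d w = 0 for every d = 1, …, D then v·A_0 w = 0. There is a constant C depending only on L and D such that: if X is a set of k distinct points in 𝕋 with the property that for every positive integer n and every subtorus 𝒯 of 𝕋^L, the set A(n)X is not ε-dense in any translate of 𝒯, then k ≤ C · ‖A_*‖_∞^{4D(L(L+1)+1)} · (1/ε)^{4D(L+1)}. -/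
open scoped BigOperators
open Matrix

/-- The one-dimensional torus `𝕋 = ℝ/ℤ`. -/
abbrev Torus1 := AddCircle (1 : ℝ)

/-- Action of an `L × N` integer matrix on the torus `𝕋^N`, by left multiplication. -/
noncomputable def torusAct {L N : ℕ} (A : Matrix (Fin L) (Fin N) ℤ) (x : Fin N → Torus1) :
    Fin L → Torus1 :=
  fun i => ∑ j, A i j • x j

/-- `Y` is `ε`-dense in the full torus `𝕋^L`: every point of `𝕋^L` is within distance `ε`
of some element of `Y` in every coordinate. -/
def EpsDense {L : ℕ} (Y : Set (Fin L → Torus1)) (ε : ℝ) : Prop :=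
  ∀ t : Fin L → Torus1, ∃ y ∈ Y, ∀ i, dist (y i) (t i) ≤ ε

/-- `Y` is `ε`-dense in a subset `S` of `𝕋^L`. -/
def EpsDenseIn {L : ℕ} (Y S : Set (Fin L → Torus1)) (ε : ℝ) : Prop :=
  ∀ s ∈ S, ∃ y ∈ Y, ∀ i, dist (y i) (s i) ≤ ε

/-- A subtorus of `𝕋^L`: a nontrivial closed connected (Lie) subgroup. -/
def IsSubtorus {L : ℕ} (T : AddSubgroup (Fin L → Torus1)) : Prop :=
  IsClosed (T : Set (Fin L → Torus1)) ∧ IsConnected (T : Set (Fin L → Torus1)) ∧ T ≠ ⊥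

/-- The translate `t + 𝒯` of a subtorus. -/
def translateOf {L : ℕ} (t : Fin L → Torus1) (T : AddSubgroup (Fin L → Torus1)) :
    Set (Fin L → Torus1) :=
  (fun y => t + y) '' (T : Set (Fin L → Torus1))

/-- Evaluation at an integer `n` of the matrix of polynomials
`A(x) = A 0 + x • A 1 + ⋯ + x^D • A D`. -/
def evalMat {L N D : ℕ} (A : Fin (D + 1) → Matrix (Fin L) (Fin N) ℤ) (n : ℤ) :
    Matrix (Fin L) (Fin N) ℤ :=
  ∑ d : Fin (D + 1), n ^ (d : ℕ) • A d

/-- Condition (a): the columns of the non-constant part `A_*(x)` are `ℚ`-linearly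
independent, i.e. the only `w ∈ ℚ^N` with `A_*(x) w ≡ 0` is `w = 0`. -/
def CondA {L N D : ℕ} (A : Fin (D + 1) → Matrix (Fin L) (Fin N) ℤ) : Prop :=
  ∀ w : Fin N → ℚ,
    (∀ d : Fin (D + 1), d ≠ 0 → ((A d).map ((↑) : ℤ → ℚ)).mulVec w = 0) → w = 0

/-- Condition (b): whenever `v ⬝ A_d w = 0` for all `d = 1, …, D`, also `v ⬝ A_0 w = 0`. -/
def CondB {L N D : ℕ} (A : Fin (D + 1) → Matrix (Fin L) (Fin N) ℤ) : Prop :=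
  ∀ (v : Fin L → ℚ) (w : Fin N → ℚ),
    (∀ d : Fin (D + 1), d ≠ 0 → v ⬝ᵥ ((A d).map ((↑) : ℤ → ℚ)).mulVec w = 0) →
    v ⬝ᵥ ((A 0).map ((↑) : ℤ → ℚ)).mulVec w = 0

/-- `‖A_*‖_∞`: the maximum of the absolute values of the integer coefficients appearing
in the non-constant part of `A`. -/
def starNorm {L N D : ℕ} (A : Fin (D + 1) → Matrix (Fin L) (Fin N) ℤ) : ℕ :=
  (Finset.univ.filter (fun d : Fin (D + 1) => d ≠ 0)).sup fun d =>
    Finset.univ.sup fun p : Fin L × Fin N => (A d p.1 p.2).natAbs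

open Filter Topology in
/-- The limit of Cesàro averages along an ultrafilter, for a bounded sequence. -/
theorem exists_hyperfilter_tendsto_average (f : ℕ → ℂ) (B : ℝ) (hB : ∀ n, ‖f n‖ ≤ B) :
    ∃ z, Tendsto (fun N : ℕ => (∑ n ∈ Finset.range N, f n) / (N : ℂ)) (hyperfilter ℕ : Filter ℕ)
      (𝓝 z) := by
  have hB0 : 0 ≤ B := (norm_nonneg _).trans (hB 0)
  have hK : IsCompact (Metric.closedBall (0 : ℂ) B) := isCompact_closedBall _ _
  obtain ⟨z, -, hz⟩ := hK.ultrafilter_le_nhds'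
    ((hyperfilter ℕ).map (fun N : ℕ => (∑ n ∈ Finset.range N, f n) / (N : ℂ))) (by
      rw [Ultrafilter.mem_map]
      refine Filter.univ_mem' fun N => ?_
      simp only [Set.mem_preimage, mem_closedBall_zero_iff, norm_div, Complex.norm_natCast]
      refine div_le_of_le_mul₀ (by positivity) hB0 ?_
      calc ‖∑ n ∈ Finset.range N, f n‖ ≤ ∑ n ∈ Finset.range N, B :=
            norm_sum_le_of_le _ fun n _ => hB n
        _ = B * N := by simp [mul_comm])
  exact ⟨z, hz⟩

/-- A shift-invariant mean on bounded sequences, extended linearly to all sequences. -/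
structure IsInvMean (M : (ℕ → ℂ) →ₗ[ℂ] ℂ) : Prop where
  one : M (fun _ => 1) = 1
  shift_one : ∀ (f : ℕ → ℂ) (B : ℝ), (∀ n, ‖f n‖ ≤ B) → M (fun n => f (n + 1)) = M f
  mono : ∀ (f : ℕ → ℂ) (c B : ℝ), (∀ n, ‖f n‖ ≤ B) → (∀ n, c ≤ (f n).re) → c ≤ (M f).re

/-- The subspace of bounded complex sequences. -/
def boundedSeq : Submodule ℂ (ℕ → ℂ) where
  carrier := {f | ∃ B : ℝ, ∀ n, ‖f n‖ ≤ B}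
  add_mem' := by
    rintro f g ⟨B, hB⟩ ⟨B', hB'⟩
    exact ⟨B + B', fun n => (norm_add_le _ _).trans (add_le_add (hB n) (hB' n))⟩
  zero_mem' := ⟨0, by simp⟩
  smul_mem' := by
    rintro c f ⟨B, hB⟩
    exact ⟨‖c‖ * B, fun n => by
      simpa using mul_le_mul_of_nonneg_left (hB n) (norm_nonneg c)⟩

open Filter Topology in
theorem exists_isInvMean : ∃ M : (ℕ → ℂ) →ₗ[ℂ] ℂ, IsInvMean M := by
  have key : ∀ f : boundedSeq, ∃ z, Tendsto
      (fun N : ℕ => (∑ n ∈ Finset.range N, f.1 n) / (N : ℂ)) (hyperfilter ℕ : Filter ℕ) (𝓝 z) := by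
    rintro ⟨f, B, hB⟩
    exact exists_hyperfilter_tendsto_average f B hB
  choose m hm using key
  have hle : (hyperfilter ℕ : Filter ℕ) ≤ atTop := Nat.hyperfilter_le_atTop
  let M₀ : boundedSeq →ₗ[ℂ] ℂ :=
    { toFun := m
      map_add' := fun f g => by
        refine tendsto_nhds_unique (hm (f + g)) (((hm f).add (hm g)).congr fun N => ?_)
        simp [Finset.sum_add_distrib, add_div]
      map_smul' := fun c f => by
        refine tendsto_nhds_unique (hm (c • f)) (((hm f).const_mul c).congr fun N => ?_)
        simp [← Finset.mul_sum, mul_div_assoc] }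
  obtain ⟨M, hM⟩ := LinearMap.exists_extend M₀
  have hMm : ∀ (f : ℕ → ℂ) (hf : f ∈ boundedSeq), M f = m ⟨f, hf⟩ := fun f hf =>
    LinearMap.congr_fun hM ⟨f, hf⟩
  refine ⟨M, ?_, ?_, ?_⟩
  · rw [hMm _ ⟨1, by simp⟩]
    refine tendsto_nhds_unique (hm _) ((tendsto_const_nhds (x := (1 : ℂ))).congr' ?_)
    filter_upwards [hle (eventually_gt_atTop 0)] with N hN
    have : (N : ℂ) ≠ 0 := by exact_mod_cast hN.ne'
    simp [this]
  · intro f B hB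
    rw [hMm f ⟨B, hB⟩, hMm _ ⟨B, fun n => hB (n + 1)⟩]
    refine tendsto_nhds_unique (hm _) ?_
    have h0 : Tendsto (fun N : ℕ => (f N - f 0) / (N : ℂ)) atTop (𝓝 0) := by
      rw [tendsto_zero_iff_norm_tendsto_zero]
      have h1 : Tendsto (fun N : ℕ => (2 * B) / (N : ℝ)) atTop (𝓝 0) :=
        tendsto_const_div_atTop_nhds_zero_nat _
      refine squeeze_zero (fun _ => norm_nonneg _) (fun N => ?_) h1
      rw [norm_div, Complex.norm_natCast]
      gcongr
      calc _ ≤ ‖f N‖ + ‖f 0‖ := norm_sub_le _ _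
        _ ≤ 2 * B := by linarith [hB N, hB 0]
    have := (hm ⟨f, B, hB⟩).add (h0.mono_left hle)
    rw [add_zero] at this
    refine this.congr fun N => ?_
    rw [← add_div]
    congr 1
    have h1 := Finset.sum_range_succ f N
    have h2 := Finset.sum_range_succ' f N
    simp only at h1 h2 ⊢
    linear_combination h2 - h1
  · intro f c B hB hc
    rw [hMm f ⟨B, hB⟩]
    have h1 := (Complex.continuous_re.tendsto _).comp (hm ⟨f, B, hB⟩)
    refine ge_of_tendsto h1 ?_
    filter_upwards [hle (eventually_gt_atTop 0)] with N hN
    have hN' : (0 : ℝ) < N := by exact_mod_cast hN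
    simp only [Function.comp_apply]
    rw [← Complex.ofReal_natCast, Complex.div_ofReal_re, le_div_iff₀ hN', Complex.re_sum]
    calc c * N = ∑ n ∈ Finset.range N, c := by simp [mul_comm]
      _ ≤ _ := Finset.sum_le_sum fun n _ => hc n

namespace IsInvMean

theorem const {M : (ℕ → ℂ) →ₗ[ℂ] ℂ} (hM : IsInvMean M) (c : ℂ) : M (fun _ => c) = c := by
  have : (fun _ : ℕ => c) = c • (fun _ : ℕ => (1 : ℂ)) := by ext; simp
  rw [this, map_smul, hM.one]; simp

theorem shift {M : (ℕ → ℂ) →ₗ[ℂ] ℂ} (hM : IsInvMean M)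
    (f : ℕ → ℂ) (B : ℝ) (hB : ∀ n, ‖f n‖ ≤ B) (h : ℕ) :
    M (fun n => f (n + h)) = M f := by
  induction h with
  | zero => rfl
  | succ h ih =>
    rw [← ih, ← hM.shift_one (fun n => f (n + h)) B (fun n => hB _)]
    congr 1; ext n; congr 1; ring

/-- Averaging over finitely many shifts does not change the mean. -/
theorem average {M : (ℕ → ℂ) →ₗ[ℂ] ℂ} (hM : IsInvMean M)
    (f : ℕ → ℂ) (B : ℝ) (hB : ∀ n, ‖f n‖ ≤ B) (a q : ℕ) (hq : 0 < q) :
    M f = M (fun n => (∑ h ∈ Finset.range q, f (n + a * h)) / q) := by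
  have : (fun n => (∑ h ∈ Finset.range q, f (n + a * h)) / q) =
      (q : ℂ)⁻¹ • ∑ h ∈ Finset.range q, (fun n => f (n + a * h)) := by
    ext n; simp [div_eq_inv_mul]
  rw [this, map_smul, map_sum, Finset.sum_congr rfl fun h _ => hM.shift f B hB (a * h)]
  have : (q : ℂ) ≠ 0 := by exact_mod_cast hq.ne'
  simp [this]

theorem norm_le_re {M : (ℕ → ℂ) →ₗ[ℂ] ℂ} (hM : IsInvMean M)
    (f : ℕ → ℂ) (g : ℕ → ℝ) (B : ℝ) (hB : ∀ n, g n ≤ B)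
    (hfg : ∀ n, ‖f n‖ ≤ g n) : ‖M f‖ ≤ (M (fun n => (g n : ℂ))).re := by
  obtain ⟨z, hz1, hz⟩ : ∃ z : ℂ, ‖z‖ = 1 ∧ z * M f = ‖M f‖ := by
    by_cases h : M f = 0
    · exact ⟨1, by simp, by simp [h]⟩
    · have h' : ‖M f‖ ≠ 0 := by simpa using h
      refine ⟨‖M f‖ / M f, ?_, by field_simp⟩
      simp [h']
  have h1 := hM.mono ((fun n => (g n : ℂ)) - z • f) 0 (2 * B) (fun n => ?_) (fun n => ?_)
  · rw [map_sub, map_smul, smul_eq_mul, hz] at h1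
    simpa using h1
  · have h0 : 0 ≤ g n := (norm_nonneg _).trans (hfg n)
    calc _ ≤ ‖(g n : ℂ)‖ + ‖z • f n‖ := norm_sub_le _ _
      _ = g n + ‖f n‖ := by simp [hz1, abs_of_nonneg h0]
      _ ≤ 2 * B := by linarith [hB n, hfg n]
  · have : (z * f n).re ≤ g n := (Complex.re_le_norm _).trans (by simpa [hz1] using hfg n)
    simpa using this

theorem norm_le {M : (ℕ → ℂ) →ₗ[ℂ] ℂ} (hM : IsInvMean M)
    (f : ℕ → ℂ) (B : ℝ) (hB : ∀ n, ‖f n‖ ≤ B) : ‖M f‖ ≤ B := by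
  simpa [hM.const] using hM.norm_le_re f (fun _ => B) B (fun _ => le_rfl) hB

/-- The mean of a periodic sequence is its average over a period. -/
theorem periodic {M : (ℕ → ℂ) →ₗ[ℂ] ℂ} (hM : IsInvMean M)
    (f : ℕ → ℂ) (q : ℕ) (hq : 0 < q) (hf : ∀ n, f (n + q) = f n) :
    M f = (∑ r ∈ Finset.range q, f r) / q := by
  have hper : Function.Periodic f q := hf
  have hB : ∀ n, ‖f n‖ ≤ ∑ r ∈ Finset.range q, ‖f r‖ := fun n => by
    rw [← hper.map_mod_nat n]
    exact Finset.single_le_sum (f := fun r => ‖f r‖) (fun _ _ => norm_nonneg _)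
      (Finset.mem_range.2 (Nat.mod_lt _ hq))
  rw [hM.average f _ hB 1 q hq]
  have : ∀ n, ∑ h ∈ Finset.range q, f (n + 1 * h) = ∑ r ∈ Finset.range q, f r := fun n => by
    induction n with
    | zero => simp
    | succ n ih =>
      rw [← ih]
      have h1 := Finset.sum_range_succ (fun h => f (n + 1 * h)) q
      have h2 := Finset.sum_range_succ' (fun h => f (n + 1 * h)) q
      have h3 : f (n + 1 * q) = f (n + 1 * 0) := by simpa using hf n
      have h4 : ∀ h, f (n + 1 + 1 * h) = f (n + 1 * (h + 1)) := fun h => by congr 1; ring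
      simp only [h4]
      rw [h3] at h1
      exact add_right_cancel (h2.symm.trans h1)
  simp only [this]
  exact hM.const _

/-- The mean of the square of the modulus bounds the square of the modulus of the mean. -/
theorem norm_sq_le {M : (ℕ → ℂ) →ₗ[ℂ] ℂ} (hM : IsInvMean M)
    (f : ℕ → ℂ) (B : ℝ) (hB : ∀ n, ‖f n‖ ≤ B) :
    ‖M f‖ ^ 2 ≤ (M (fun n => ((‖f n‖ ^ 2 : ℝ) : ℂ))).re := by
  set c := M f with hc
  have hfun : (fun n => ((‖f n - c‖ ^ 2 : ℝ) : ℂ)) =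
      (fun n => ((‖f n‖ ^ 2 : ℝ) : ℂ)) - (fun n => (((2 : ℝ) * (star c * f n).re : ℝ) : ℂ))
        + fun _ => ((‖c‖ ^ 2 : ℝ) : ℂ) := by
    ext n
    simp only [Pi.add_apply, Pi.sub_apply]
    norm_cast
    rw [← Complex.normSq_eq_norm_sq, ← Complex.normSq_eq_norm_sq, ← Complex.normSq_eq_norm_sq,
      Complex.normSq_sub]
    simp [mul_comm]
    ring
  have hB0 : 0 ≤ B := (norm_nonneg _).trans (hB 0)
  have hre : (M (fun n => (((2 : ℝ) * (star c * f n).re : ℝ) : ℂ))).re ≥ 2 * ‖c‖ ^ 2 := by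
    have h1 := hM.mono ((fun n => (((2 : ℝ) * (star c * f n).re : ℝ) : ℂ)) - (2 * star c) • f) 0
      (4 * ‖c‖ * B) (fun n => ?_) (fun n => ?_)
    · rw [map_sub, map_smul, ← hc, smul_eq_mul] at h1
      have h2 : (2 * star c * c).re = 2 * ‖c‖ ^ 2 := by
        rw [mul_assoc, Complex.star_def, mul_comm _ c, Complex.mul_conj, Complex.normSq_eq_norm_sq]
        norm_cast
      rw [Complex.sub_re, h2] at h1
      linarith
    · have h1 : ‖(((2 : ℝ) * (star c * f n).re : ℝ) : ℂ)‖ ≤ 2 * (‖c‖ * B) := by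
        rw [Complex.norm_real, norm_mul]
        simp only [Real.norm_eq_abs, abs_two]
        gcongr
        refine (Complex.abs_re_le_norm _).trans ?_
        rw [norm_mul, norm_star]
        gcongr
        exact hB n
      have h2 : ‖(2 * star c) • f n‖ ≤ 2 * (‖c‖ * B) := by
        rw [norm_smul, norm_mul, norm_star, mul_assoc]
        have := hB n
        simp only [Complex.norm_ofNat]
        gcongr
      refine (norm_sub_le _ _).trans ((add_le_add h1 h2).trans_eq ?_)
      ring
    · simp [mul_assoc]
  have h0 := hM.mono (fun n => ((‖f n - c‖ ^ 2 : ℝ) : ℂ)) 0 ((B + ‖c‖) ^ 2) (fun n => ?_)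
    (fun n => by rw [Complex.ofReal_re]; positivity)
  · rw [hfun, map_add, map_sub, hM.const] at h0
    simp only [Complex.add_re, Complex.sub_re, Complex.ofReal_re] at h0
    linarith
  · rw [Complex.norm_real, Real.norm_of_nonneg (by positivity)]
    gcongr
    exact (norm_sub_le _ _).trans (by linarith [hB n])

end IsInvMean

/-- The standard character `x ↦ exp (2πix)` of the one-dimensional torus. -/
noncomputable def circ (y : Torus1) : ℂ := (AddCircle.toCircle y : ℂ)

theorem circ_add (x y : Torus1) : circ (x + y) = circ x * circ y := by
  simp [circ, AddCircle.toCircle_add]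

@[simp] theorem circ_zero : circ 0 = 1 := by simp [circ]

@[simp] theorem norm_circ (y : Torus1) : ‖circ y‖ = 1 := Circle.norm_coe _

theorem star_circ (y : Torus1) : star (circ y) = circ (-y) := by
  rw [circ, circ, AddCircle.toCircle_neg, Circle.coe_inv_eq_conj, Complex.star_def]

theorem circ_eq_one_iff (y : Torus1) : circ y = 1 ↔ y = 0 := by
  have h := AddCircle.injective_toCircle (T := (1 : ℝ)) one_ne_zero
  constructor
  · intro hy
    apply h
    ext
    simpa [circ] using hy
  · rintro rfl; simp

theorem circ_sum {ι : Type*} (s : Finset ι) (f : ι → Torus1) :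
    circ (∑ i ∈ s, f i) = ∏ i ∈ s, circ (f i) := by
  classical
  induction s using Finset.induction_on with
  | empty => simp
  | insert a s ha ih => rw [Finset.sum_insert ha, Finset.prod_insert ha, circ_add, ih]

theorem circ_nsmul (n : ℕ) (y : Torus1) : circ (n • y) = circ y ^ n := by
  induction n with
  | zero => simp
  | succ n ih => rw [succ_nsmul, circ_add, ih, pow_succ]

/-- Orthogonality on the cyclic group generated by a torsion point. -/
theorem sum_range_circ_nsmul (q : ℕ) (z : Torus1) (hz : q • z = 0) [Decidable (z = 0)] :
    ∑ h ∈ Finset.range q, circ (h • z) = if z = 0 then (q : ℂ) else 0 := by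
  split_ifs with h
  · simp [h]
  · have h1 : circ z ≠ 1 := fun h' => h ((circ_eq_one_iff z).1 h')
    simp only [circ_nsmul]
    rw [geom_sum_eq h1, ← circ_nsmul, hz]
    simp

section Taylor

open Polynomial

theorem taylor_coeff_of_natDegree_le {R : Type*} [CommRing R] (P : R[X]) (N : ℕ)
    (hP : P.natDegree ≤ N + 1) (r : R) :
    (taylor r P).coeff N = P.coeff N + (N + 1) * P.coeff (N + 1) * r := by
  rw [taylor_coeff, eval_eq_sum_range' (n := 2)
    (lt_of_le_of_lt (natDegree_hasseDeriv_le P N) (by omega))]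
  simp [Finset.sum_range_succ, hasseDeriv_coeff, add_comm 1 N, Nat.choose_succ_self_right]

theorem natDegree_taylor_sub_taylor (P : ℤ[X]) (N : ℕ) (hP : P.natDegree = N + 1) {a b : ℤ}
    (hab : a ≠ b) (hN : 0 < N) : (taylor a P - taylor b P).natDegree = N := by
  have hlead : P.coeff (N + 1) ≠ 0 := by
    rw [← hP]
    simp only [coeff_natDegree, ne_eq, leadingCoeff_eq_zero]
    rintro rfl
    simp at hP
  apply natDegree_eq_of_le_of_coeff_ne_zero
  · rw [natDegree_le_iff_coeff_eq_zero]
    intro m hm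
    rcases Nat.lt_or_ge (N + 1) m with h | h
    · rw [coeff_sub, coeff_eq_zero_of_natDegree_lt, coeff_eq_zero_of_natDegree_lt, sub_zero] <;>
      simpa [natDegree_taylor, hP] using h
    · obtain rfl : m = N + 1 := by omega
      rw [coeff_sub, ← hP, coeff_taylor_natDegree, coeff_taylor_natDegree, sub_self]
  · rw [coeff_sub, taylor_coeff_of_natDegree_le P N hP.le, taylor_coeff_of_natDegree_le P N hP.le]
    have : P.coeff N + (N + 1) * P.coeff (N + 1) * a - (P.coeff N + (N + 1) * P.coeff (N + 1) * b)
        = (N + 1) * P.coeff (N + 1) * (a - b) := by ring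
    rw [this]
    exact mul_ne_zero (mul_ne_zero (by positivity) hlead) (sub_ne_zero.2 hab)

end Taylor

open Polynomial in
/-- The mean value of the exponential `n ↦ exp (2πi P(n) y)`. -/
noncomputable def expMean (M : (ℕ → ℂ) →ₗ[ℂ] ℂ) (P : ℤ[X]) (y : Torus1) : ℂ :=
  M fun n : ℕ => circ (P.eval (n : ℤ) • y)

namespace IsInvMean

open Polynomial

theorem norm_expMean_le_one {M : (ℕ → ℂ) →ₗ[ℂ] ℂ} (hM : IsInvMean M)
    (P : ℤ[X]) (y : Torus1) : ‖expMean M P y‖ ≤ 1 :=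
  hM.norm_le _ _ fun n => by simp

/-- Van der Corput's inequality for an invariant mean: a sequence of modulus one whose
correlations vanish has mean zero. -/
theorem eq_zero_of_correlations {M : (ℕ → ℂ) →ₗ[ℂ] ℂ} (hM : IsInvMean M)
    (f : ℕ → ℂ) (hf : ∀ n, ‖f n‖ = 1)
    (hcor : ∀ h h' : ℕ, h ≠ h' → M (fun n => f (n + h) * star (f (n + h'))) = 0) : M f = 0 := by
  have key : ∀ H : ℕ, 0 < H → ‖M f‖ ^ 2 ≤ 1 / H := fun H hH => by
    have hH0 : (H : ℂ) ≠ 0 := by exact_mod_cast hH.ne'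
    have h1 := hM.average f 1 (fun n => (hf n).le) 1 H hH
    have h2 := hM.norm_sq_le (fun n => (∑ h ∈ Finset.range H, f (n + 1 * h)) / H) 1 (fun n => by
      rw [norm_div, Complex.norm_natCast]
      refine div_le_of_le_mul₀ (by positivity) zero_le_one ?_
      refine (norm_sum_le_of_le _ (fun h _ => (hf _).le)).trans ?_
      simp)
    rw [← h1] at h2
    refine h2.trans_eq ?_
    have h3 : (fun n : ℕ => ((‖(∑ h ∈ Finset.range H, f (n + 1 * h)) / H‖ ^ 2 : ℝ) : ℂ)) =
        ((H : ℂ) ^ 2)⁻¹ • ∑ h ∈ Finset.range H, ∑ h' ∈ Finset.range H,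
          (fun n => f (n + h) * star (f (n + h'))) := by
      ext n
      simp only [one_mul, Pi.smul_apply, Finset.sum_apply, smul_eq_mul]
      rw [← Complex.normSq_eq_norm_sq, ← Complex.mul_conj, map_div₀, map_sum,
        div_mul_div_comm, Finset.sum_mul_sum]
      simp only [Complex.star_def, Complex.conj_natCast]
      rw [div_eq_inv_mul, sq]
    have h4 : M (∑ h ∈ Finset.range H, ∑ h' ∈ Finset.range H,
          (fun n => f (n + h) * star (f (n + h')))) = H := by
      simp only [map_sum]
      have : ∀ h ∈ Finset.range H, ∑ h' ∈ Finset.range H,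
          M (fun n => f (n + h) * star (f (n + h'))) = 1 := fun h hh => by
        rw [Finset.sum_eq_single_of_mem h hh fun h' _ hne => hcor h h' hne.symm]
        rw [← hM.one]
        congr 1
        ext n
        rw [Complex.star_def, Complex.mul_conj, Complex.normSq_eq_norm_sq, hf]
        simp
      rw [Finset.sum_congr rfl this]
      simp
    rw [h3, map_smul, h4, smul_eq_mul]
    have : ((H : ℂ) ^ 2)⁻¹ * H = ((1 / H : ℝ) : ℂ) := by
      push_cast
      field_simp
    rw [this, Complex.ofReal_re]
  by_contra hne
  have hpos : 0 < ‖M f‖ ^ 2 := by positivity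
  obtain ⟨H, hH⟩ := exists_nat_gt (1 / ‖M f‖ ^ 2)
  have hH0 : (0 : ℝ) < H := lt_trans (by positivity) hH
  have := key H (by exact_mod_cast hH0)
  rw [le_div_iff₀ hH0] at this
  rw [div_lt_iff₀ hpos] at hH
  linarith

/-- Weyl's theorem for polynomials evaluated at a point of infinite order. -/
theorem expMean_eq_zero {M : (ℕ → ℂ) →ₗ[ℂ] ℂ} (hM : IsInvMean M)
    (y : Torus1) (hy : ¬ IsOfFinAddOrder y) (N : ℕ) :
    ∀ P : ℤ[X], P.natDegree = N + 1 → expMean M P y = 0 := by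
  induction N with
  | zero =>
    intro P hP
    obtain ⟨a, ha, b, rfl⟩ := natDegree_eq_one.1 hP
    have h1 := hM.shift_one (fun n : ℕ => circ ((C a * X + C b : ℤ[X]).eval (n : ℤ) • y)) 1
      (fun n => by simp)
    have h2 : (fun n : ℕ => circ ((C a * X + C b : ℤ[X]).eval ((n + 1 : ℕ) : ℤ) • y)) =
        circ (a • y) • (fun n : ℕ => circ ((C a * X + C b : ℤ[X]).eval (n : ℤ) • y)) := by
      ext n
      simp only [Pi.smul_apply, smul_eq_mul]
      rw [← circ_add, ← add_smul]
      congr 2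
      simp
      ring
    rw [h2, map_smul, smul_eq_mul] at h1
    change _ * expMean M _ y = expMean M _ y at h1
    have h3 : circ (a • y) ≠ 1 := by
      rw [Ne, circ_eq_one_iff]
      intro h
      exact hy (isOfFinAddOrder_iff_zsmul_eq_zero.2 ⟨a, ha, h⟩)
    have h4 : (circ (a • y) - 1) * expMean M (C a * X + C b) y = 0 := by
      rw [sub_mul, h1, one_mul, sub_self]
    exact (mul_eq_zero.1 h4).resolve_left (sub_ne_zero.2 h3)
  | succ N ih =>
    intro P hP
    refine hM.eq_zero_of_correlations _ (fun n => by simp) fun h h' hne => ?_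
    rw [← ih (taylor (h : ℤ) P - taylor (h' : ℤ) P)
      (natDegree_taylor_sub_taylor P (N + 1) hP (by exact_mod_cast hne) (by omega))]
    unfold expMean
    congr 1
    ext n
    rw [star_circ, ← circ_add, ← neg_smul, ← add_smul]
    congr 2
    simp [taylor_eval, sub_eq_add_neg]

end IsInvMean

theorem Prime.pow_sub_dvd_of_pow_dvd_mul {p : ℤ} (hp : Prime p) {J m : ℕ} {a b : ℤ}
    (h : p ^ J ∣ a * b) (ha : ¬ p ^ m ∣ a) : p ^ (J - (m - 1)) ∣ b := by
  have ha0 : a ≠ 0 := by rintro rfl; exact ha (dvd_zero _)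
  obtain ⟨a', haa', hpa'⟩ :=
    (FiniteMultiplicity.of_prime_left hp ha0).exists_eq_pow_mul_and_not_dvd
  set v := multiplicity p a
  have hv : v < m := by
    by_contra hv
    exact ha (haa' ▸ (pow_dvd_pow p (not_lt.1 hv)).mul_right a')
  rcases Nat.lt_or_ge J v with hJ | hJ
  · have : J - (m - 1) = 0 := by omega
    simp [this]
  · have h1 : p ^ v * p ^ (J - v) ∣ p ^ v * (a' * b) := by
      rw [← pow_add, Nat.add_sub_cancel' hJ, ← mul_assoc, ← haa']
      exact h
    have h2 : p ^ (J - v) ∣ a' * b := (mul_dvd_mul_iff_left (pow_ne_zero _ hp.ne_zero)).1 h1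
    exact (pow_dvd_pow p (by omega)).trans (hp.pow_dvd_of_dvd_mul_left _ hpa' h2)

open Polynomial in
/-- A polynomial of degree at most `d` which is `p`-adically small at `d + 1` points that are
`p`-adically separated has `p`-adically small coefficients. -/
theorem C_pow_dvd_of_pow_dvd_eval {p : ℤ} (hp : Prime p) (m d : ℕ) :
    ∀ (f : ℤ[X]) (J : ℕ) (s : Finset ℤ), f.natDegree ≤ d → s.card = d + 1 →
      (∀ a ∈ s, p ^ J ∣ f.eval a) → (∀ a ∈ s, ∀ b ∈ s, a ≠ b → ¬ p ^ m ∣ a - b) →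
      C (p ^ (J - (m - 1) * d)) ∣ f := by
  induction d with
  | zero =>
    intro f J s hf hs hJ _
    obtain ⟨a, rfl⟩ := Finset.card_eq_one.1 hs
    obtain ⟨b, rfl⟩ := natDegree_eq_zero.1 (Nat.le_zero.1 hf)
    exact map_dvd C (by simpa using hJ a (by simp))
  | succ d ih =>
    intro f J s hf hs hJ hsep
    obtain ⟨a, ha⟩ : s.Nonempty := Finset.card_pos.1 (by omega)
    set g := f /ₘ (X - C a) with hg
    have hfg : f = (X - C a) * g + C (f.eval a) := by
      have := modByMonic_add_div f (X - C a)
      rw [modByMonic_X_sub_C_eq_C_eval] at this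
      rw [add_comm]
      exact this.symm
    have hgd : g.natDegree ≤ d := by
      rw [hg, natDegree_divByMonic _ (monic_X_sub_C a), natDegree_X_sub_C]
      omega
    have h1 := ih g (J - (m - 1)) (s.erase a) hgd (by rw [Finset.card_erase_of_mem ha]; omega)
      (fun b hb => by
        have hb' := Finset.mem_erase.1 hb
        have h2 : (b - a) * g.eval b = f.eval b - f.eval a := by
          conv_rhs => rw [hfg]
          simp
        refine hp.pow_sub_dvd_of_pow_dvd_mul (a := b - a) ?_ (hsep b hb'.2 a ha hb'.1)
        rw [h2]
        exact dvd_sub (hJ b hb'.2) (hJ a ha))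
      (fun b hb b' hb' => hsep b (Finset.mem_of_mem_erase hb) b' (Finset.mem_of_mem_erase hb'))
    have h3 : J - (m - 1) - (m - 1) * d = J - (m - 1) * (d + 1) := by
      rw [Nat.sub_sub]; congr 1; ring
    rw [h3] at h1
    rw [hfg]
    refine dvd_add (h1.mul_left _) ?_
    exact (map_dvd C ((pow_dvd_pow p (Nat.sub_le _ _)).trans (hJ a ha)))

namespace IsInvMean

open Polynomial

theorem mod_eq_indicator {M : (ℕ → ℂ) →ₗ[ℂ] ℂ} (hM : IsInvMean M) (q r : ℕ) (hr : r < q) :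
    M (fun n => if n % q = r then 1 else 0) = 1 / q := by
  rw [hM.periodic _ q (by omega) (fun n => by simp)]
  congr 1
  rw [Finset.sum_congr rfl (g := fun x => if x = r then (1 : ℂ) else 0)
    (fun x hx => by rw [Nat.mod_eq_of_lt (Finset.mem_range.1 hx)])]
  simp [hr]

/-- A `p`-adic sublevel set estimate. -/
theorem norm_le_of_pow_dvd_eval {M : (ℕ → ℂ) →ₗ[ℂ] ℂ} (hM : IsInvMean M)
    {p : ℕ} (hp : p.Prime) (F : ℤ[X]) (J m d c : ℕ)
    (hF : F.natDegree ≤ d) (hc : ¬ C ((p : ℤ) ^ (c + 1)) ∣ F) (hJ : (m - 1) * d + c < J)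
    (f : ℕ → ℂ) (hf1 : ∀ n, ‖f n‖ ≤ 1)
    (hf0 : ∀ n : ℕ, ¬ (p : ℤ) ^ J ∣ F.eval (n : ℤ) → f n = 0) :
    ‖M f‖ ≤ d / (p : ℝ) ^ m := by
  classical
  have hq : 0 < p ^ m := pow_pos hp.pos m
  set R := (Finset.range (p ^ m)).filter
    (fun r => ∃ n : ℕ, n % p ^ m = r ∧ (p : ℤ) ^ J ∣ F.eval (n : ℤ)) with hR
  have hcard : R.card ≤ d := by
    by_contra hcon
    obtain ⟨s, hsR, hs⟩ := Finset.exists_subset_card_eq (Nat.succ_le_of_lt (not_le.1 hcon))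
    have hex : ∀ r : s, ∃ n : ℕ, n % p ^ m = r ∧ (p : ℤ) ^ J ∣ F.eval (n : ℤ) := fun r =>
      (Finset.mem_filter.1 (hsR r.2)).2
    choose n hn hnF using hex
    have hinj : Function.Injective (fun r : s => (n r : ℤ)) := fun r r' h => by
      have : n r = n r' := by
        have hcast : (n r : ℤ) = n r' := h
        exact_mod_cast hcast
      exact Subtype.ext (by rw [← hn r, ← hn r', this])
    have hdvd := C_pow_dvd_of_pow_dvd_eval (Nat.prime_iff_prime_int.1 hp) m d F J
      (Finset.univ.image (fun r : s => (n r : ℤ))) hF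
      (by rw [Finset.card_image_of_injective _ hinj]; simpa using hs)
      (by
        intro a ha
        obtain ⟨r, -, rfl⟩ := Finset.mem_image.1 ha
        exact hnF r)
      (by
        intro a ha b hb hab hdiv
        obtain ⟨r, -, rfl⟩ := Finset.mem_image.1 ha
        obtain ⟨r', -, rfl⟩ := Finset.mem_image.1 hb
        apply hab
        have h1 : n r' ≡ n r [MOD p ^ m] := by
          rw [Nat.modEq_iff_dvd]
          exact_mod_cast hdiv
        have : r = r' := Subtype.ext (by rw [← hn r, ← hn r']; exact h1.symm)
        rw [this])
    exact hc ((map_dvd C (pow_dvd_pow (p : ℤ) (by omega))).trans hdvd)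
  have hfun : (fun n => ((∑ r ∈ R, if n % p ^ m = r then (1 : ℝ) else 0 : ℝ) : ℂ)) =
      ∑ r ∈ R, fun n => if n % p ^ m = r then (1 : ℂ) else 0 := by
    ext n
    rw [Complex.ofReal_sum, Finset.sum_apply]
    refine Finset.sum_congr rfl fun r _ => ?_
    split_ifs <;> simp
  refine (hM.norm_le_re f (fun n => ∑ r ∈ R, if n % p ^ m = r then (1 : ℝ) else 0) R.card
    (fun n => ?_) (fun n => ?_)).trans ?_
  · refine (Finset.sum_le_card_nsmul _ _ 1 fun r _ => ?_).trans_eq (by simp)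
    split_ifs <;> norm_num
  · by_cases h : (p : ℤ) ^ J ∣ F.eval (n : ℤ)
    · have hmem : n % p ^ m ∈ R :=
        Finset.mem_filter.2 ⟨Finset.mem_range.2 (Nat.mod_lt _ hq), n, rfl, h⟩
      rw [Finset.sum_ite_eq, if_pos hmem]
      exact hf1 n
    · rw [hf0 n h, norm_zero]
      exact Finset.sum_nonneg fun r _ => by split_ifs <;> norm_num
  · rw [hfun, map_sum, Finset.sum_congr rfl fun r hr =>
      hM.mod_eq_indicator (p ^ m) r (Finset.mem_range.1 (Finset.mem_filter.1 hr).1)]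
    rw [Finset.sum_const, nsmul_eq_mul]
    have : (R.card : ℂ) * (1 / ((p ^ m : ℕ) : ℂ)) = ((R.card / (p : ℝ) ^ m : ℝ) : ℂ) := by
      push_cast; ring
    rw [this, Complex.ofReal_re]
    gcongr

/-- For a point of order `p ^ t`, only those `n` at which the derivative of `P` is divisible by
`p ^ (t / 2)` contribute to the exponential mean. -/
theorem expMean_eq_indicator {M : (ℕ → ℂ) →ₗ[ℂ] ℂ} (hM : IsInvMean M)
    {p : ℕ} (hp : p.Prime) (P : ℤ[X]) (t : ℕ) (y : Torus1)
    (hy : addOrderOf y = p ^ t) :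
    expMean M P y = M (fun n : ℕ => if (p : ℤ) ^ (t / 2) ∣ (derivative P).eval (n : ℤ) then
      circ (P.eval (n : ℤ) • y) else 0) := by
  classical
  set j := t - t / 2 with hj
  have hjt : j + t / 2 = t := by omega
  have hq0 : 0 < p ^ (t / 2) := pow_pos hp.pos _
  have hp0 : (p : ℤ) ≠ 0 := by exact_mod_cast hp.ne_zero
  unfold expMean
  rw [hM.average _ 1 (fun n => by simp) (p ^ j) (p ^ (t / 2)) hq0]
  congr 1
  ext n
  set z := ((derivative P).eval (n : ℤ) * (p : ℤ) ^ j) • y with hz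
  have hterm : ∀ h : ℕ, circ (P.eval ((n + p ^ j * h : ℕ) : ℤ) • y) =
      circ (P.eval (n : ℤ) • y) * circ (h • z) := fun h => by
    obtain ⟨k, hk⟩ := P.binomExpansion (n : ℤ) ((p : ℤ) ^ j * h)
    rw [← circ_add]
    congr 1
    have h1 : (k * ((p : ℤ) ^ j * h) ^ 2) • y = 0 := by
      rw [← addOrderOf_dvd_iff_zsmul_eq_zero, hy]
      push_cast
      rw [mul_pow, ← pow_mul]
      exact ((pow_dvd_pow (p : ℤ) (by omega)).mul_right _).mul_left _
    push_cast
    rw [hk, add_smul, h1, add_zero, add_smul, hz, ← natCast_zsmul, smul_smul]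
    congr 2
    ring
  have hqz : (p ^ (t / 2)) • z = 0 := by
    rw [hz, ← natCast_zsmul, smul_smul, ← addOrderOf_dvd_iff_zsmul_eq_zero, hy]
    push_cast
    rw [mul_left_comm, ← pow_add, add_comm, hjt]
    exact dvd_mul_left _ _
  have hz0 : z = 0 ↔ (p : ℤ) ^ (t / 2) ∣ (derivative P).eval (n : ℤ) := by
    rw [hz, ← addOrderOf_dvd_iff_zsmul_eq_zero, hy]
    push_cast
    rw [← hjt, pow_add, mul_comm, mul_dvd_mul_iff_right (pow_ne_zero _ hp0), hjt]
  simp only [hterm]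
  rw [← Finset.mul_sum, sum_range_circ_nsmul _ z hqz]
  have hq0' : ((p ^ (t / 2) : ℕ) : ℂ) ≠ 0 := by exact_mod_cast hq0.ne'
  simp only [hz0]
  split_ifs
  · rw [mul_div_assoc, div_self hq0', mul_one]
  · simp

/-- Exponential means at points of order `p ^ t`, for `t` not too small. -/
theorem norm_expMean_pow_le_of_large {M : (ℕ → ℂ) →ₗ[ℂ] ℂ} (hM : IsInvMean M)
    {p : ℕ} (hp : p.Prime) (D : ℕ) (P : ℤ[X])
    (hPD : P.natDegree ≤ D) (i c : ℕ) (hi : 1 ≤ i) (hiD : i ≤ D)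
    (hpi : ¬ (p : ℤ) ∣ P.coeff i) (hci : p ^ c ∣ i) (hci' : ¬ p ^ (c + 1) ∣ i)
    (t : ℕ) (ht : 2 + 2 * c ≤ t) (y : Torus1) (hy : addOrderOf y = p ^ t) :
    ‖expMean M P y‖ ^ (2 * D) * (p : ℝ) ^ (t + 1) ≤ (D : ℝ) ^ (2 * D + 2) := by
  have hD : 1 ≤ D := hi.trans hiD
  set m := (t - 2 * c) / (2 * D) + 1 with hm
  have hm1 : t - 2 * c < 2 * D * m := by
    rw [hm]; exact Nat.lt_mul_div_succ _ (by omega)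
  have hm2 : (m - 1) * (D - 1) + c < t / 2 := by
    have h1 : (m - 1) * (2 * D) ≤ t - 2 * c := by
      rw [hm, Nat.add_sub_cancel]; exact Nat.div_mul_le_self _ _
    obtain ⟨E, rfl⟩ : ∃ E, D = E + 1 := ⟨D - 1, by omega⟩
    have hE : E + 1 - 1 = E := rfl
    rw [hE]
    rcases Nat.eq_zero_or_pos (m - 1) with h0 | h0
    · rw [h0]; omega
    · have : (m - 1) * (2 * (E + 1)) = 2 * ((m - 1) * E) + 2 * (m - 1) := by ring
      omega
  clear_value m
  have hb : ‖expMean M P y‖ ≤ D / (p : ℝ) ^ m := by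
    rw [hM.expMean_eq_indicator hp P t y hy]
    refine (hM.norm_le_of_pow_dvd_eval hp (derivative P) (t / 2) m (D - 1) c
      ((natDegree_derivative_le P).trans (by omega)) ?_ hm2 _ (fun n => ?_)
      (fun n hn => ?_)).trans ?_
    · intro hdvd
      have h1 := (C_dvd_iff_dvd_coeff _ _).1 hdvd (i - 1)
      rw [coeff_derivative, Nat.sub_add_cancel hi] at h1
      have h2 := (Nat.prime_iff_prime_int.1 hp).pow_dvd_of_dvd_mul_left _ hpi h1
      apply hci'
      have h3 : ((i - 1 : ℕ) : ℤ) + 1 = i := by omega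
      rw [h3] at h2
      exact_mod_cast h2
    · split_ifs <;> simp
    · rw [if_neg hn]
    · gcongr; omega
  have hp1 : (1 : ℝ) ≤ p := by exact_mod_cast hp.one_le
  have hpc : (p : ℝ) ^ c ≤ D := by
    exact_mod_cast (Nat.le_of_dvd hi hci).trans hiD
  calc ‖expMean M P y‖ ^ (2 * D) * (p : ℝ) ^ (t + 1)
      ≤ (D / (p : ℝ) ^ m) ^ (2 * D) * (p : ℝ) ^ (2 * D * m + 2 * c) := by
        exact mul_le_mul (pow_le_pow_left₀ (norm_nonneg _) hb _)
          (pow_le_pow_right₀ hp1 (by omega)) (by positivity) (by positivity)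
    _ = D ^ (2 * D) * ((p : ℝ) ^ c) ^ 2 := by
        have : (p : ℝ) ≠ 0 := by positivity
        rw [div_pow, pow_add, ← pow_mul, ← pow_mul, mul_comm m, mul_comm c]
        field_simp
    _ ≤ D ^ (2 * D) * (D : ℝ) ^ 2 := by gcongr
    _ = _ := by rw [pow_add]

/-- The exponential mean is multiplicative along the primary decomposition. -/
theorem expMean_add {M : (ℕ → ℂ) →ₗ[ℂ] ℂ} (hM : IsInvMean M)
    (P : ℤ[X]) (q₁ q₂ : ℕ) (hq : q₁.Coprime q₂) (hq₁ : 0 < q₁)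
    (y₁ y₂ : Torus1) (hy₁ : q₁ • y₁ = 0) (hy₂ : q₂ • y₂ = 0) :
    expMean M P (y₁ + y₂) = expMean M P y₁ * expMean M P y₂ := by
  have hper : ∀ (q : ℕ) (y : Torus1), q • y = 0 → ∀ a b : ℕ, a ≡ b [MOD q] →
      circ (P.eval (a : ℤ) • y) = circ (P.eval (b : ℤ) • y) := fun q y hy a b hab => by
    congr 1
    rw [← sub_eq_zero, ← sub_smul]
    have h1 : (q : ℤ) ∣ P.eval (a : ℤ) - P.eval (b : ℤ) :=
      ((Nat.modEq_iff_dvd.1 hab.symm)).trans (sub_dvd_eval_sub _ _ _)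
    obtain ⟨k, hk⟩ := h1
    rw [hk, mul_comm, mul_smul, natCast_zsmul, hy, smul_zero]
  have h1 : expMean M P (y₁ + y₂) =
      M (fun n : ℕ => circ (P.eval (n : ℤ) • y₁) * circ (P.eval (n : ℤ) • y₂)) := by
    unfold expMean
    congr 1; ext n
    rw [smul_add, circ_add]
  have h2 : expMean M P y₁ = (∑ r ∈ Finset.range q₁, circ (P.eval (r : ℤ) • y₁)) / q₁ :=
    hM.periodic _ q₁ hq₁ (fun n => hper q₁ y₁ hy₁ _ _ (by simp [Nat.ModEq]))
  rw [h1, hM.average _ 1 (fun n => by simp) q₂ q₁ hq₁, h2]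
  unfold expMean
  rw [← smul_eq_mul, ← map_smul]
  congr 1
  ext n
  rw [Pi.smul_apply, smul_eq_mul, div_mul_eq_mul_div]
  congr 1
  have h3 : ∀ h, circ (P.eval ((n + q₂ * h : ℕ) : ℤ) • y₂) = circ (P.eval (n : ℤ) • y₂) := fun h =>
    hper q₂ y₂ hy₂ _ _ (by simp [Nat.ModEq])
  simp only [h3]
  rw [← Finset.sum_mul]
  congr 1
  have hmaps : Set.MapsTo (fun h => (n + q₂ * h) % q₁) (Finset.range q₁) (Finset.range q₁) :=
    fun h _ => by simpa using Nat.mod_lt _ hq₁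
  have hinj : Set.InjOn (fun h => (n + q₂ * h) % q₁) (Finset.range q₁ : Set ℕ) := by
    intro a ha b hb hab
    have h4 : n + q₂ * a ≡ n + q₂ * b [MOD q₁] := hab
    have h5 : a ≡ b [MOD q₁] :=
      Nat.ModEq.cancel_left_of_coprime hq (Nat.ModEq.add_left_cancel' n h4)
    exact Nat.ModEq.eq_of_lt_of_lt h5 (by simpa using ha) (by simpa using hb)
  exact Finset.sum_nbij _ hmaps hinj (Finset.surjOn_of_injOn_of_card_le _ hmaps hinj le_rfl)
    (fun h _ => hper q₁ y₁ hy₁ _ _ (Nat.mod_modEq _ _).symm)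

end IsInvMean

section Mordell

theorem AddChar.map_finset_sum {A R ι : Type*} [AddCommMonoid A] [CommMonoid R] (ψ : AddChar A R)
    (s : Finset ι) (f : ι → A) : ψ (∑ i ∈ s, f i) = ∏ i ∈ s, ψ (f i) := by
  classical
  induction s using Finset.induction_on with
  | empty => simp
  | insert a s ha ih => rw [Finset.sum_insert ha, Finset.prod_insert ha, map_add_eq_mul, ih]

/-- Two families of `D` elements of a field with the same power sums of order `1, …, D` agree up
to a permutation, provided that `1, …, D` are invertible. -/
theorem exists_perm_of_sum_pow_eq {F : Type*} [Field F] [DecidableEq F] {D : ℕ}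
    (hD : ∀ k : ℕ, 1 ≤ k → k ≤ D → (k : F) ≠ 0) (x y : Fin D → F)
    (h : ∀ j : Fin D, ∑ i, x i ^ (j + 1 : ℕ) = ∑ i, y i ^ (j + 1 : ℕ)) :
    ∃ σ : Equiv.Perm (Fin D), x = y ∘ σ := by
  have hes : ∀ k ≤ D, MvPolynomial.aeval x (MvPolynomial.esymm (Fin D) F k) =
      MvPolynomial.aeval y (MvPolynomial.esymm (Fin D) F k) := by
    intro k
    induction k using Nat.strong_induction_on with
    | _ k ih =>
      intro hk
      rcases Nat.eq_zero_or_pos k with rfl | hk0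
      · simp
      have hn := fun z : Fin D → F =>
        congrArg (MvPolynomial.aeval z) (MvPolynomial.mul_esymm_eq_sum (Fin D) F k)
      simp only [map_mul, map_sum, map_pow, map_neg, map_one, map_natCast, MvPolynomial.psum,
        MvPolynomial.aeval_X] at hn
      apply mul_left_cancel₀ (hD k hk0 hk)
      rw [hn x, hn y]
      congr 1
      refine Finset.sum_congr rfl fun a ha => ?_
      simp only [Finset.mem_filter, Finset.HasAntidiagonal.mem_antidiagonal] at ha
      rw [ih a.1 ha.2 (by omega)]
      congr 1
      have h1 := h ⟨a.2 - 1, by omega⟩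
      simp only [Nat.sub_add_cancel (show 1 ≤ a.2 by omega)] at h1
      exact h1
  have hprod : ((Finset.univ.val.map x).map fun t => Polynomial.X - Polynomial.C t).prod =
      ((Finset.univ.val.map y).map fun t => Polynomial.X - Polynomial.C t).prod := by
    rw [Multiset.prod_X_sub_X_eq_sum_esymm, Multiset.prod_X_sub_X_eq_sum_esymm]
    simp only [Multiset.card_map]
    refine Finset.sum_congr rfl fun j hj => ?_
    have hjD : j ≤ D := by simpa [Nat.lt_succ_iff] using hj
    rw [← MvPolynomial.aeval_esymm_eq_multiset_esymm (Fin D) F,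
      ← MvPolynomial.aeval_esymm_eq_multiset_esymm (Fin D) F, hes j hjD]
  have hms : Finset.univ.val.map x = Finset.univ.val.map y := by
    have := congrArg Polynomial.roots hprod
    rwa [Polynomial.roots_multiset_prod_X_sub_C, Polynomial.roots_multiset_prod_X_sub_C] at this
  have hcard : ∀ c, Fintype.card {i // x i = c} = Fintype.card {i // y i = c} := fun c => by
    have h1 := congrArg (Multiset.count c) hms
    rw [Multiset.count_map, Multiset.count_map] at h1
    simp only [Fintype.card_subtype]
    simpa [Finset.card, Finset.filter, eq_comm] using h1
  refine ⟨Equiv.ofFiberEquiv fun c => Fintype.equivOfCardEq (hcard c), funext fun i => ?_⟩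
  exact (Equiv.ofFiberEquiv_map _ i).symm

theorem card_sum_pow_eq_le {F : Type*} [Field F] [Fintype F] [DecidableEq F] {D : ℕ}
    (hD : ∀ k : ℕ, 1 ≤ k → k ≤ D → (k : F) ≠ 0) :
    (Finset.univ.filter fun z : (Fin D → F) × (Fin D → F) =>
      ∀ j : Fin D, ∑ i, z.1 i ^ (j + 1 : ℕ) = ∑ i, z.2 i ^ (j + 1 : ℕ)).card ≤
      D.factorial * Fintype.card F ^ D := by
  classical
  have hsub : (Finset.univ.filter fun z : (Fin D → F) × (Fin D → F) =>
      ∀ j : Fin D, ∑ i, z.1 i ^ (j + 1 : ℕ) = ∑ i, z.2 i ^ (j + 1 : ℕ)) ⊆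
      (Finset.univ : Finset (Equiv.Perm (Fin D) × (Fin D → F))).image
        (fun w => (w.2 ∘ w.1, w.2)) := by
    intro z hz
    obtain ⟨σ, hσ⟩ := exists_perm_of_sum_pow_eq hD z.1 z.2 (Finset.mem_filter.1 hz).2
    exact Finset.mem_image.2 ⟨(σ, z.2), Finset.mem_univ _, by rw [← hσ]⟩
  refine (Finset.card_le_card hsub).trans (Finset.card_image_le.trans_eq ?_)
  simp [Fintype.card_perm]

variable {F : Type*} [Field F] [Fintype F] [DecidableEq F] {ψ : AddChar F ℂ}

theorem sum_pi_addChar (hψ : ψ.IsPrimitive) {D : ℕ} (β : Fin D → F) :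
    ∑ α : Fin D → F, ψ (∑ j, α j * β j) = if β = 0 then (Fintype.card F : ℂ) ^ D else 0 := by
  have h1 : ∀ α : Fin D → F, ψ (∑ j, α j * β j) = ∏ j, ψ (α j * β j) := fun α => by
    rw [AddChar.map_finset_sum]
  simp only [h1]
  rw [← Fintype.prod_sum (fun j (a : F) => ψ (a * β j))]
  simp only [AddChar.sum_mulShift _ hψ]
  split_ifs with h
  · simp [h]
  · obtain ⟨j, hj⟩ := Function.ne_iff.1 h
    exact Finset.prod_eq_zero (Finset.mem_univ j) (by simpa using hj)

/-- The mean value of the `2D`-th power of a complete exponential sum over all polynomials of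
degree at most `D`. -/
theorem sum_norm_pow_le (hψ : ψ.IsPrimitive) {D : ℕ}
    (hD : ∀ k : ℕ, 1 ≤ k → k ≤ D → (k : F) ≠ 0) :
    ∑ α : Fin D → F, ‖∑ x, ψ (∑ j, α j * x ^ (j + 1 : ℕ))‖ ^ (2 * D) ≤
      D.factorial * (Fintype.card F : ℝ) ^ (2 * D) := by
  have hterm : ∀ α : Fin D → F,
      ((‖∑ x, ψ (∑ j, α j * x ^ (j + 1 : ℕ))‖ ^ (2 * D) : ℝ) : ℂ) =
      ∑ z : (Fin D → F) × (Fin D → F),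
        ψ (∑ j, α j * (∑ i, z.1 i ^ (j + 1 : ℕ) - ∑ i, z.2 i ^ (j + 1 : ℕ))) := fun α => by
    rw [pow_mul]
    push_cast
    rw [← Complex.mul_conj', map_sum, mul_pow, Fintype.sum_pow, Fintype.sum_pow,
      Fintype.sum_mul_sum, ← Fintype.sum_prod_type']
    refine Finset.sum_congr rfl fun z _ => ?_
    simp only [← AddChar.map_neg_eq_conj]
    rw [← AddChar.map_finset_sum, ← AddChar.map_finset_sum, ← AddChar.map_add_eq_mul]
    refine congrArg ψ ?_
    rw [Finset.sum_neg_distrib, ← sub_eq_add_neg, Finset.sum_comm,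
      Finset.sum_comm (f := fun i j => α j * z.2 i ^ (j + 1 : ℕ)), ← Finset.sum_sub_distrib]
    exact Finset.sum_congr rfl fun j _ => by rw [mul_sub, Finset.mul_sum, Finset.mul_sum]
  have hsum : ((∑ α : Fin D → F, ‖∑ x, ψ (∑ j, α j * x ^ (j + 1 : ℕ))‖ ^ (2 * D) : ℝ) : ℂ) =
      (((Finset.univ.filter fun z : (Fin D → F) × (Fin D → F) =>
      ∀ j : Fin D, ∑ i, z.1 i ^ (j + 1 : ℕ) = ∑ i, z.2 i ^ (j + 1 : ℕ)).card *
        (Fintype.card F : ℝ) ^ D : ℝ) : ℂ) := by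
    rw [Complex.ofReal_sum]
    simp only [hterm]
    rw [Finset.sum_comm]
    simp only [sum_pi_addChar hψ]
    rw [← Finset.sum_filter, Finset.sum_const, nsmul_eq_mul]
    push_cast
    simp only [funext_iff, Pi.zero_apply, sub_eq_zero]
  rw [Complex.ofReal_injective hsum, two_mul, pow_add, ← mul_assoc]
  gcongr
  exact_mod_cast card_sum_pow_eq_le hD

open Polynomial

/-- The orbit of a polynomial under affine substitutions consists of many polynomials. -/
theorem card_affine_fiber_le {D : ℕ} (f : F[X]) (e : ℕ) (he : f.natDegree = e) (he2 : 2 ≤ e)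
    (heD : e ≤ D) (he0 : (e : F) ≠ 0) (α : Fin D → F) :
    (Finset.univ.filter fun w : Fˣ × F =>
      (fun j : Fin D => ((taylor w.2 f).comp (C (w.1 : F) * X)).coeff (j + 1)) = α).card ≤ D := by
  classical
  have hf : f.coeff e ≠ 0 := by
    rw [← he, coeff_natDegree, Ne, leadingCoeff_eq_zero]
    rintro rfl
    simp at he
    omega
  have htop : ∀ v, (taylor v f).coeff e = f.coeff e := fun v => by
    rw [← he, coeff_taylor_natDegree, leadingCoeff]
  obtain ⟨N, rfl⟩ : ∃ N, e = N + 1 := ⟨e - 1, by omega⟩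
  have hnext := taylor_coeff_of_natDegree_le f N he.le
  set a := α ⟨N, by omega⟩
  set b := α ⟨N - 1, by omega⟩
  have hmem : ∀ w : Fˣ × F,
      (fun j : Fin D => ((taylor w.2 f).comp (C (w.1 : F) * X)).coeff (j + 1)) = α →
      f.coeff (N + 1) * (w.1 : F) ^ (N + 1) = a ∧
      (f.coeff N + (N + 1) * f.coeff (N + 1) * w.2) * (w.1 : F) ^ N = b := fun w hw => by
    have h1 := congrFun hw ⟨N, by omega⟩
    have h2 := congrFun hw ⟨N - 1, by omega⟩
    simp only [comp_C_mul_X_coeff, htop, Nat.sub_add_cancel (show 1 ≤ N by omega), hnext] at h1 h2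
    exact ⟨h1, h2⟩
  calc _ ≤ (nthRoots (N + 1) (a / f.coeff (N + 1))).toFinset.card := by
        refine Finset.card_le_card_of_injOn (fun w => (w.1 : F)) (fun w hw => ?_) ?_
        · have h1 := (hmem w (Finset.mem_filter.1 hw).2).1
          simp only [Finset.mem_coe, Multiset.mem_toFinset]
          rw [mem_nthRoots (Nat.succ_pos N), eq_div_iff hf, mul_comm]
          exact h1
        · intro w hw w' hw' hww
          have h1 := (hmem w (Finset.mem_filter.1 hw).2).2
          have h2 := (hmem w' (Finset.mem_filter.1 hw').2).2
          have hu : w.1 = w'.1 := Units.ext hww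
          rw [← h2, hu] at h1
          have h3 := add_left_cancel
            (mul_right_cancel₀ (pow_ne_zero _ (Units.ne_zero w'.1)) h1)
          refine Prod.ext hu (mul_left_cancel₀ (mul_ne_zero ?_ hf) h3)
          exact_mod_cast he0
    _ ≤ N + 1 := (Multiset.toFinset_card_le _).trans (card_nthRoots _ _)
    _ ≤ D := heD

/-- Mordell's bound for complete exponential sums over a finite field. -/
theorem mordell_bound (hψ : ψ.IsPrimitive) {D : ℕ}
    (hD : ∀ k : ℕ, 1 ≤ k → k ≤ D → (k : F) ≠ 0) (f : F[X]) (hf : 1 ≤ f.natDegree)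
    (hfD : f.natDegree ≤ D) :
    (Fintype.card Fˣ : ℝ) * Fintype.card F * ‖∑ x, ψ (f.eval x)‖ ^ (2 * D) ≤
      D * D.factorial * (Fintype.card F : ℝ) ^ (2 * D) := by
  rcases hf.eq_or_lt with h1 | h2
  · have hdeg : f = C (f.coeff 1) * X + C (f.coeff 0) := eq_X_add_C_of_natDegree_le_one h1.ge
    have hc : f.coeff 1 ≠ 0 := by
      rw [h1, coeff_natDegree, Ne, leadingCoeff_eq_zero]
      rintro rfl
      simp at h1
    have hz : ∑ x, ψ (f.eval x) = 0 := by
      have h3 : ∀ x, ψ (f.eval x) = ψ (x * f.coeff 1) * ψ (f.coeff 0) := fun x => by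
        conv_lhs => rw [hdeg]
        rw [eval_add, eval_mul, eval_C, eval_C, eval_X, AddChar.map_add_eq_mul, mul_comm x]
      simp only [h3]
      rw [← Finset.sum_mul, AddChar.sum_mulShift _ hψ, if_neg hc]
      simp
    rw [hz, norm_zero, zero_pow (by omega), mul_zero]
    positivity
  · set S : (Fin D → F) → ℝ := fun α => ‖∑ x, ψ (∑ j, α j * x ^ (j + 1 : ℕ))‖ ^ (2 * D) with hS
    set φ : Fˣ × F → (Fin D → F) :=
      fun w j => ((taylor w.2 f).comp (C (w.1 : F) * X)).coeff (j + 1) with hφ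
    have horb : ∀ w : Fˣ × F, S (φ w) = ‖∑ x, ψ (f.eval x)‖ ^ (2 * D) := fun w => by
      set Q := (taylor w.2 f).comp (C (w.1 : F) * X) with hQ
      have hQD : Q.natDegree < D + 1 := by
        refine lt_of_le_of_lt (natDegree_comp_le.trans ?_) (Nat.lt_succ_of_le hfD)
        rw [natDegree_taylor]
        exact (Nat.mul_le_mul_left _ (natDegree_C_mul_le _ _)).trans_eq (by simp)
      have heval : ∀ x, Q.eval x = f.eval (w.1 * x + w.2) := fun x => by
        simp [hQ, taylor_eval, add_comm]
      have hψQ : ∀ x, ψ (Q.eval x) = ψ (Q.coeff 0) * ψ (∑ j : Fin D, φ w j * x ^ (j + 1 : ℕ)) :=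
        fun x => by
          rw [← AddChar.map_add_eq_mul, eval_eq_sum_range' hQD, Finset.sum_range_succ',
            Finset.sum_range, add_comm]
          simp [hφ, hQ]
      have hbij : Function.Bijective (fun x : F => (w.1 : F) * x + w.2) :=
        Finite.injective_iff_bijective.1 fun x x' hx =>
          mul_left_cancel₀ w.1.ne_zero (add_right_cancel hx)
      rw [← hbij.sum_comp (fun x => ψ (f.eval x))]
      simp only [← heval, hψQ]
      rw [← Finset.mul_sum, norm_mul, AddChar.norm_apply, one_mul]
    have hsum : ∑ w : Fˣ × F, S (φ w) ≤ D * ∑ α, S α := by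
      rw [← Finset.sum_fiberwise_of_maps_to (t := Finset.univ) (g := φ)
        (fun _ _ => Finset.mem_univ _), Finset.mul_sum]
      refine Finset.sum_le_sum fun α _ => ?_
      rw [Finset.sum_congr rfl (g := fun _ => S α)
        (fun w hw => by rw [(Finset.mem_filter.1 hw).2]), Finset.sum_const, nsmul_eq_mul]
      have := card_affine_fiber_le f _ rfl h2 hfD (hD _ hf hfD) α
      gcongr
    simp only [horb, Finset.sum_const, Finset.card_univ, Fintype.card_prod, nsmul_eq_mul] at hsum
    push_cast at hsum
    refine hsum.trans ?_
    rw [mul_assoc (D : ℝ)]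
    exact mul_le_mul_of_nonneg_left (sum_norm_pow_le hψ hD) (by positivity)

end Mordell

namespace IsInvMean

open Polynomial

/-- Exponential means at points of prime order. -/
theorem norm_expMean_pow_le_of_prime {M : (ℕ → ℂ) →ₗ[ℂ] ℂ} (hM : IsInvMean M)
    {p : ℕ} (hp : p.Prime) (D : ℕ) (hDp : D < p) (P : ℤ[X])
    (hPD : P.natDegree ≤ D) (i : ℕ) (hi : 1 ≤ i) (hpi : ¬ (p : ℤ) ∣ P.coeff i)
    (y : Torus1) (hy : addOrderOf y = p) :
    ‖expMean M P y‖ ^ (2 * D) * (p : ℝ) ^ 2 ≤ 2 * D * D.factorial := by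
  have : Fact p.Prime := ⟨hp⟩
  have hpy : p • y = 0 := by rw [← hy]; exact addOrderOf_nsmul_eq_zero y
  have hζ : circ y ^ p = 1 := by rw [← circ_nsmul, hpy, circ_zero]
  set ψ := AddChar.zmodChar p hζ with hψdef
  have hψ : ψ.IsPrimitive := by
    refine AddChar.IsPrimitive.of_ne_one fun h => ?_
    have h1 : ψ ((1 : ℕ) : ZMod p) = 1 := by rw [h]; rfl
    rw [hψdef, AddChar.zmodChar_apply', pow_one, circ_eq_one_iff] at h1
    rw [h1, addOrderOf_zero] at hy
    exact hp.one_lt.ne hy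
  have hψint : ∀ a : ℤ, circ (a • y) = ψ (a : ZMod p) := fun a => by
    obtain ⟨k, n, rfl⟩ : ∃ (k : ℤ) (n : ℕ), a = k * p + n := by
      refine ⟨a / p, (a % p).toNat, ?_⟩
      rw [Int.toNat_of_nonneg (Int.emod_nonneg _ (by exact_mod_cast hp.ne_zero))]
      exact (Int.ediv_mul_add_emod _ _).symm
    have h1 : ((k * p + n : ℤ) : ZMod p) = (n : ZMod p) := by simp
    rw [h1, hψdef, AddChar.zmodChar_apply', add_smul, mul_smul, natCast_zsmul, hpy, smul_zero,
      zero_add, natCast_zsmul, circ_nsmul]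
  set f := P.map (Int.castRingHom (ZMod p)) with hf
  have hval : ∀ n : ℕ, circ (P.eval (n : ℤ) • y) = ψ (f.eval (n : ZMod p)) := fun n => by
    rw [hψint, hf, eval_natCast_map, eq_intCast]
  have hmean : expMean M P y = (∑ x : ZMod p, ψ (f.eval x)) / p := by
    unfold expMean
    rw [hM.periodic _ p hp.pos (fun n => by rw [hval, hval]; simp)]
    congr 1
    refine Finset.sum_nbij' (fun n : ℕ => (n : ZMod p)) ZMod.val (by simp)
      (fun x _ => Finset.mem_range.2 (ZMod.val_lt x))
      (fun n hn => ZMod.val_cast_of_lt (Finset.mem_range.1 hn)) (fun x _ => by simp)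
      (fun n _ => hval n)
  have hfi : f.coeff i ≠ 0 := by
    rw [hf, coeff_map, eq_intCast, Ne, ZMod.intCast_zmod_eq_zero_iff_dvd]
    exact hpi
  have hb := mordell_bound hψ (D := D) (fun k hk hkD h => by
      rw [ZMod.natCast_eq_zero_iff] at h
      exact absurd (Nat.le_of_dvd hk h) (by omega)) f
    (hi.trans (le_natDegree_of_ne_zero hfi)) ((natDegree_map_le).trans hPD)
  rw [ZMod.card, ZMod.card_units] at hb
  have hp0 : (0 : ℝ) < p := by exact_mod_cast hp.pos
  have hS : ‖∑ x : ZMod p, ψ (f.eval x)‖ = ‖expMean M P y‖ * p := by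
    rw [hmean, norm_div, Complex.norm_natCast, div_mul_cancel₀ _ hp0.ne']
  have h2 : (p : ℝ) ≤ 2 * (p - 1 : ℕ) := by
    have := hp.two_le
    exact_mod_cast (show p ≤ 2 * (p - 1) by omega)
  rw [hS, mul_pow] at hb
  have h3 : ((p - 1 : ℕ) : ℝ) * p * ‖expMean M P y‖ ^ (2 * D) ≤ D * D.factorial := by
    refine le_of_mul_le_mul_right ?_ (pow_pos hp0 (2 * D))
    linarith
  calc ‖expMean M P y‖ ^ (2 * D) * (p : ℝ) ^ 2 = ‖expMean M P y‖ ^ (2 * D) * p * p := by ring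
    _ ≤ ‖expMean M P y‖ ^ (2 * D) * p * (2 * (p - 1 : ℕ)) := by gcongr
    _ = 2 * (((p - 1 : ℕ) : ℝ) * p * ‖expMean M P y‖ ^ (2 * D)) := by ring
    _ ≤ 2 * (D * D.factorial) := by gcongr
    _ = _ := by ring

/-- Exponential means at points of prime power order. -/
theorem norm_expMean_pow_le_of_prime_pow {M : (ℕ → ℂ) →ₗ[ℂ] ℂ} (hM : IsInvMean M)
    {p : ℕ} (hp : p.Prime) (D : ℕ) (P : ℤ[X])
    (hPD : P.natDegree ≤ D) (i : ℕ) (hi : 1 ≤ i) (hpi : ¬ (p : ℤ) ∣ P.coeff i)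
    (t : ℕ) (ht : 1 ≤ t) (y : Torus1) (hy : addOrderOf y = p ^ t) :
    ‖expMean M P y‖ ^ (2 * D) * (p : ℝ) ^ (t + 1) ≤
      (D : ℝ) ^ (2 * D + 2) + (D : ℝ) ^ 4 + 2 * D * D.factorial := by
  have hiD : i ≤ D := (le_natDegree_of_ne_zero fun h => hpi (h ▸ dvd_zero _)).trans hPD
  have hD1 : 1 ≤ D := hi.trans hiD
  obtain ⟨c, u, hu, hic⟩ := Nat.exists_eq_pow_mul_and_not_dvd (by omega : i ≠ 0) p hp.ne_one
  have hci : p ^ c ∣ i := hic ▸ dvd_mul_right _ _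
  have hci' : ¬ p ^ (c + 1) ∣ i := fun h => by
    rw [hic, pow_succ] at h
    exact hu ((Nat.mul_dvd_mul_iff_left (pow_pos hp.pos c)).1 h)
  have h0 : (0 : ℝ) ≤ (D : ℝ) ^ (2 * D + 2) := by positivity
  have h1 : (0 : ℝ) ≤ (D : ℝ) ^ 4 := by positivity
  have h2 : (0 : ℝ) ≤ 2 * D * D.factorial := by positivity
  have hp1 : (1 : ℝ) ≤ p := by exact_mod_cast hp.one_le
  have hN : ‖expMean M P y‖ ^ (2 * D) ≤ 1 :=
    pow_le_one₀ (norm_nonneg _) (hM.norm_expMean_le_one P y)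
  have htriv : (p : ℝ) ^ (t + 1) ≤ (D : ℝ) ^ 4 → ‖expMean M P y‖ ^ (2 * D) * (p : ℝ) ^ (t + 1) ≤
      (D : ℝ) ^ (2 * D + 2) + (D : ℝ) ^ 4 + 2 * D * D.factorial := fun h => by
    have := mul_le_mul hN h (by positivity) zero_le_one
    linarith
  rcases Nat.lt_or_ge t (2 + 2 * c) with hlt | hge
  · rcases Nat.eq_zero_or_pos c with rfl | hc
    · obtain rfl : t = 1 := by omega
      rcases Nat.lt_or_ge D p with hDp | hDp
      · have := hM.norm_expMean_pow_le_of_prime hp D hDp P hPD i hi hpi y (by simpa using hy)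
        simp only [Nat.reduceAdd]
        linarith
      · apply htriv
        calc (p : ℝ) ^ (1 + 1) ≤ (D : ℝ) ^ 2 := by gcongr
          _ ≤ (D : ℝ) ^ 4 := pow_le_pow_right₀ (by exact_mod_cast hD1) (by norm_num)
    · apply htriv
      calc (p : ℝ) ^ (t + 1) ≤ (p : ℝ) ^ (c * 4) := pow_le_pow_right₀ hp1 (by omega)
        _ = ((p : ℝ) ^ c) ^ 4 := pow_mul _ _ _
        _ ≤ (D : ℝ) ^ 4 := by
          gcongr
          exact_mod_cast (Nat.le_of_dvd (by omega) hci).trans hiD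
  · have := hM.norm_expMean_pow_le_of_large hp D P hPD i c hi hiD hpi hci hci' t hge y hy
    linarith

end IsInvMean

section ArithmeticWeight

/-- The multiplicative function with value `K / p ^ (t + 1)` at a prime power `p ^ t ≠ 1`. -/
noncomputable def radWeight (K : ℝ) (q : ℕ) : ℝ := q.factorization.prod fun p t => K / p ^ (t + 1)

theorem radWeight_one (K : ℝ) : radWeight K 1 = 1 := by simp [radWeight]

theorem radWeight_mul (K : ℝ) {a b : ℕ} (hab : a.Coprime b) :
    radWeight K (a * b) = radWeight K a * radWeight K b := by
  rw [radWeight, Nat.factorization_mul_of_coprime hab,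
    Finsupp.prod_add_index_of_disjoint (by simpa using hab.disjoint_primeFactors)]
  rfl

theorem radWeight_prime_pow (K : ℝ) {p t : ℕ} (hp : p.Prime) (ht : t ≠ 0) :
    radWeight K (p ^ t) = K / p ^ (t + 1) := by
  rw [radWeight, hp.factorization_pow]
  unfold Finsupp.prod
  rw [Finsupp.support_single p ht]
  simp

theorem radWeight_nonneg {K : ℝ} (hK : 0 ≤ K) (q : ℕ) : 0 ≤ radWeight K q := by
  unfold radWeight Finsupp.prod
  exact Finset.prod_nonneg fun _ _ => by positivity

theorem exists_sum_mul_radWeight_rpow_le (K s : ℝ) (hK : 0 ≤ K) (hs : 1 < s) :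
    ∃ C : ℝ, 0 < C ∧ ∀ Q : Finset ℕ, (∀ q ∈ Q, 0 < q) →
      ∑ q ∈ Q, q * radWeight K q ^ s ≤ C := by
  set f : ℕ → ℝ := fun q => q * radWeight K q ^ s with hf
  have hf0 : ∀ q, 0 ≤ f q := fun q =>
    mul_nonneg (Nat.cast_nonneg _) (Real.rpow_nonneg (radWeight_nonneg hK q) s)
  have hf1 : f 1 = 1 := by simp [hf, radWeight_one]
  have hmul : ∀ {m n : ℕ}, Nat.Coprime m n → f (m * n) = f m * f n := fun {m n} h => by
    simp only [hf]
    rw [radWeight_mul K h, Real.mul_rpow (radWeight_nonneg hK m) (radWeight_nonneg hK n)]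
    push_cast; ring
  set ρ : ℝ := 2 ^ (1 - s) with hρ
  have hρ0 : 0 ≤ ρ := by positivity
  have hρ1 : ρ < 1 := Real.rpow_lt_one_of_one_lt_of_neg one_lt_two (by linarith)
  set g : ℕ → ℕ → ℝ := fun p t => (if t = 0 then 1 else 0) + K ^ s * (p : ℝ) ^ (-s) * ρ ^ t with hg
  have hfg : ∀ {p : ℕ}, p.Prime → ∀ t, f (p ^ t) ≤ g p t := fun {p} hp t => by
    have hp0 : (0 : ℝ) < p := by exact_mod_cast hp.pos
    rcases eq_or_ne t 0 with rfl | ht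
    · simp only [pow_zero, hf1, hg, if_pos, mul_one]
      have : 0 ≤ K ^ s * (p : ℝ) ^ (-s) := by positivity
      linarith
    · have h1 : f (p ^ t) = K ^ s * (p : ℝ) ^ (-s) * ((p : ℝ) ^ (1 - s)) ^ t := by
        simp only [hf]
        rw [radWeight_prime_pow K hp ht, Real.div_rpow hK (by positivity), ← Real.rpow_natCast,
          ← Real.rpow_natCast, ← Real.rpow_mul hp0.le, ← Real.rpow_mul hp0.le, div_eq_mul_inv,
          ← Real.rpow_neg hp0.le, Nat.cast_pow, ← Real.rpow_natCast, mul_left_comm, mul_assoc,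
          ← Real.rpow_add hp0, ← Real.rpow_add hp0]
        congr 2
        push_cast
        ring
      rw [h1, hg]
      simp only [if_neg ht, zero_add]
      gcongr
      rw [hρ]
      exact Real.rpow_le_rpow_of_nonpos two_pos (by exact_mod_cast hp.two_le) (by linarith)
  have hgs : ∀ p, HasSum (g p) (1 + K ^ s * (p : ℝ) ^ (-s) * (1 - ρ)⁻¹) := fun p =>
    (hasSum_ite_eq 0 1).add ((hasSum_geometric_of_lt_one hρ0 hρ1).mul_left _)
  have hsummable : ∀ {p : ℕ}, p.Prime → Summable fun n : ℕ => f (p ^ n) := fun {p} hp =>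
    Summable.of_nonneg_of_le (fun n => hf0 _) (hfg hp) (hgs p).summable
  have hps : Summable fun n : ℕ => (n : ℝ) ^ (-s) := Real.summable_nat_rpow.2 (by linarith)
  set B := K ^ s * (1 - ρ)⁻¹ * ∑' n : ℕ, (n : ℝ) ^ (-s) with hB
  refine ⟨Real.exp B, Real.exp_pos _, fun Q hQ => ?_⟩
  have hpos : 0 ≤ (1 - ρ)⁻¹ := inv_nonneg.2 (by linarith)
  set N := Q.sup id + 1 with hN
  have hE := (EulerProduct.summable_and_hasSum_smoothNumbers_prod_primesBelow_tsum hf1 hmul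
    (fun {p} hp => by simpa only [Real.norm_of_nonneg (hf0 _)] using hsummable hp) N).2
  have hQN : ∀ q ∈ Q, q ∈ N.smoothNumbers := fun q hq =>
    Nat.mem_smoothNumbers_of_lt (hQ q hq) (Nat.lt_succ_of_le (Finset.le_sup (f := id) hq))
  calc ∑ q ∈ Q, f q = ∑ q : {q // q ∈ Q}, f q := (Finset.sum_coe_sort Q f).symm
    _ = ∑ q ∈ Finset.univ.map ⟨fun q : {q // q ∈ Q} => (⟨q, hQN q q.2⟩ : N.smoothNumbers),
          fun a b h => Subtype.ext (congrArg (fun z : N.smoothNumbers => (z : ℕ)) h)⟩, f q := by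
        rw [Finset.sum_map]; rfl
    _ ≤ ∏ p ∈ N.primesBelow, ∑' n : ℕ, f (p ^ n) := sum_le_hasSum _ (fun _ _ => hf0 _) hE
    _ ≤ ∏ p ∈ N.primesBelow, (1 + K ^ s * (p : ℝ) ^ (-s) * (1 - ρ)⁻¹) := by
        refine Finset.prod_le_prod (fun p _ => tsum_nonneg fun _ => hf0 _) fun p hp => ?_
        rw [← (hgs p).tsum_eq]
        have hp' := Nat.prime_of_mem_primesBelow hp
        exact (hsummable hp').tsum_le_tsum (hfg hp') (hgs p).summable
    _ ≤ Real.exp (∑ p ∈ N.primesBelow, K ^ s * (p : ℝ) ^ (-s) * (1 - ρ)⁻¹) :=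
        Real.prod_one_add_le_exp_sum _ fun p => by positivity
    _ ≤ Real.exp B := by
        gcongr
        have h1 : ∑ p ∈ N.primesBelow, K ^ s * (p : ℝ) ^ (-s) * (1 - ρ)⁻¹ =
            K ^ s * (1 - ρ)⁻¹ * ∑ p ∈ N.primesBelow, (p : ℝ) ^ (-s) := by
          rw [Finset.mul_sum]; exact Finset.sum_congr rfl fun _ _ => by ring
        rw [h1, hB]
        gcongr
        exact hps.sum_le_tsum _ fun _ _ => by positivity

end ArithmeticWeight

open Polynomial in
/-- The mean value of an exponential is small at points of large order. -/
theorem IsInvMean.norm_expMean_pow_le_radWeight {M : (ℕ → ℂ) →ₗ[ℂ] ℂ} (hM : IsInvMean M) (D : ℕ)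
    (P : ℤ[X]) (hPD : P.natDegree ≤ D)
    (hP : ∀ p : ℕ, p.Prime → ∃ i, 1 ≤ i ∧ ¬ (p : ℤ) ∣ P.coeff i) (q : ℕ) :
    0 < q → ∀ y : Torus1, addOrderOf y = q → ‖expMean M P y‖ ^ (2 * D) ≤
      radWeight ((D : ℝ) ^ (2 * D + 2) + (D : ℝ) ^ 4 + 2 * D * D.factorial) q := by
  induction q using Nat.recOnPosPrimePosCoprime with
  | zero => intro h; exact absurd h (lt_irrefl 0)
  | one =>
    intro _ y _
    rw [radWeight_one]
    exact pow_le_one₀ (norm_nonneg _) (hM.norm_expMean_le_one P y)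
  | prime_pow p t hp ht =>
    intro _ y hy
    obtain ⟨i, hi, hpi⟩ := hP p hp
    rw [radWeight_prime_pow _ hp ht.ne', le_div_iff₀ (pow_pos (by exact_mod_cast hp.pos) _)]
    exact hM.norm_expMean_pow_le_of_prime_pow hp D P hPD i hi hpi t ht y hy
  | coprime a b ha hb hab iha ihb =>
    intro _ y hy
    have hz : ((a * b : ℕ) : ℤ) • y = 0 := by
      rw [natCast_zsmul, ← hy]; exact addOrderOf_nsmul_eq_zero y
    have hbez := Nat.gcd_eq_gcd_ab a b
    rw [hab.gcd_eq_one] at hbez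
    set u := a.gcdA b
    set v := a.gcdB b
    set y₁ := (b * v : ℤ) • y with hy₁
    set y₂ := (a * u : ℤ) • y with hy₂
    have hsum : y = y₁ + y₂ := by
      rw [hy₁, hy₂, ← add_smul, add_comm, ← hbez]; simp
    have h1 : a • y₁ = 0 := by
      rw [hy₁, ← natCast_zsmul, smul_smul,
        show (a : ℤ) * (b * v) = v * ((a * b : ℕ) : ℤ) by push_cast; ring, mul_smul, hz, smul_zero]
    have h2 : b • y₂ = 0 := by
      rw [hy₂, ← natCast_zsmul, smul_smul,
        show (b : ℤ) * (a * u) = u * ((a * b : ℕ) : ℤ) by push_cast; ring, mul_smul, hz, smul_zero]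
    have d1 := addOrderOf_dvd_of_nsmul_eq_zero h1
    have d2 := addOrderOf_dvd_of_nsmul_eq_zero h2
    have hord : addOrderOf y₁ * addOrderOf y₂ = a * b := by
      rw [← hy, hsum]
      exact ((AddCommute.all y₁ y₂).addOrderOf_add_eq_mul_addOrderOf_of_coprime
        (Nat.Coprime.of_dvd d1 d2 hab)).symm
    have l1 := Nat.le_of_dvd (by omega) d1
    have l2 := Nat.le_of_dvd (by omega) d2
    have e1 : addOrderOf y₁ = a := by nlinarith
    have e2 : addOrderOf y₂ = b := by nlinarith
    rw [hsum, hM.expMean_add P a b hab (by omega) y₁ y₂ h1 h2, norm_mul, mul_pow,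
      radWeight_mul _ hab]
    exact mul_le_mul (iha (by omega) y₁ e1) (ihb (by omega) y₂ e2) (by positivity)
      (radWeight_nonneg (by positivity) a)

section Moments

open Polynomial

theorem exists_sum_norm_expMean_rpow_le_of_primitive (D : ℕ) (hD : 0 < D) (s : ℝ) (hs : 1 < s) :
    ∃ C : ℝ, 0 < C ∧ ∀ M : (ℕ → ℂ) →ₗ[ℂ] ℂ, IsInvMean M → ∀ P : ℤ[X], P.natDegree ≤ D →
      (∀ p : ℕ, p.Prime → ∃ i, 1 ≤ i ∧ ¬ (p : ℤ) ∣ P.coeff i) → ∀ F : Finset Torus1,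
      ∑ y ∈ F, ‖expMean M P y‖ ^ (2 * D * s : ℝ) ≤ C := by
  classical
  set K : ℝ := (D : ℝ) ^ (2 * D + 2) + (D : ℝ) ^ 4 + 2 * D * D.factorial with hK
  have hK0 : 0 ≤ K := by positivity
  obtain ⟨C, hC, hbound⟩ := exists_sum_mul_radWeight_rpow_le K s hK0 hs
  refine ⟨C, hC, fun M hM P hPD hP F => ?_⟩
  have hr : (2 * D * s : ℝ) ≠ 0 := by positivity
  have hdeg : ∃ N, P.natDegree = N + 1 := by
    obtain ⟨i, hi, hpi⟩ := hP 2 Nat.prime_two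
    have := le_natDegree_of_ne_zero (p := P) (n := i) fun h => hpi (h ▸ dvd_zero _)
    exact ⟨P.natDegree - 1, by omega⟩
  obtain ⟨N, hN⟩ := hdeg
  set G := F.filter fun y => IsOfFinAddOrder y with hG
  calc ∑ y ∈ F, ‖expMean M P y‖ ^ (2 * D * s : ℝ)
      = ∑ y ∈ G, ‖expMean M P y‖ ^ (2 * D * s : ℝ) := by
        rw [hG, Finset.sum_filter]
        refine Finset.sum_congr rfl fun y _ => ?_
        split_ifs with h
        · rfl
        · rw [hM.expMean_eq_zero y h N P hN, norm_zero, Real.zero_rpow hr]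
    _ ≤ ∑ y ∈ G, radWeight K (addOrderOf y) ^ s := by
        refine Finset.sum_le_sum fun y hy => ?_
        have hy' := (Finset.mem_filter.1 hy).2
        rw [Real.rpow_mul (norm_nonneg _)]
        refine Real.rpow_le_rpow (by positivity) ?_ (by linarith)
        have := hM.norm_expMean_pow_le_radWeight D P hPD hP _ hy'.addOrderOf_pos y rfl
        rw [← Real.rpow_natCast, Nat.cast_mul, Nat.cast_ofNat] at this
        exact this
    _ = ∑ q ∈ G.image addOrderOf,
          (G.filter fun y => addOrderOf y = q).card • radWeight K q ^ s :=
        Finset.sum_comp (fun q => radWeight K q ^ s) addOrderOf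
    _ ≤ ∑ q ∈ G.image addOrderOf, q * radWeight K q ^ s := by
        refine Finset.sum_le_sum fun q hq => ?_
        rw [nsmul_eq_mul]
        refine mul_le_mul_of_nonneg_right ?_ (Real.rpow_nonneg (radWeight_nonneg hK0 q) s)
        obtain ⟨y, hy, rfl⟩ := Finset.mem_image.1 hq
        have hpos := (Finset.mem_filter.1 hy).2.addOrderOf_pos
        have h1 := AddCircle.card_torsion_le_of_isSMulRegular (1 : ℝ) (addOrderOf y) hpos.ne'
          (fun a b h => by simpa [hpos.ne'] using h)
        have h2 : ((G.filter fun z => addOrderOf z = addOrderOf y : Finset Torus1) :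
            Set Torus1) ⊆ {x | addOrderOf y • x = 0} := fun z hz => by
          have hz' : addOrderOf z = addOrderOf y := (Finset.mem_filter.1 hz).2
          simp only [Set.mem_ofPred_eq]
          rw [← hz']
          exact addOrderOf_nsmul_eq_zero z
        have h3 := (Set.encard_le_encard h2).trans h1
        rw [Set.encard_coe_eq_coe_finsetCard] at h3
        exact_mod_cast h3
    _ ≤ C := hbound _ fun q hq => by
        obtain ⟨y, hy, rfl⟩ := Finset.mem_image.1 hq
        exact (Finset.mem_filter.1 hy).2.addOrderOf_pos

theorem exists_sum_norm_expMean_rpow_le (D : ℕ) (hD : 0 < D) (s : ℝ) (hs : 1 < s) :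
    ∃ K : ℝ, 0 < K ∧ ∀ M : (ℕ → ℂ) →ₗ[ℂ] ℂ, IsInvMean M → ∀ P : ℤ[X], P.natDegree ≤ D →
      1 ≤ P.natDegree → ∀ B : ℝ, (∀ i, 1 ≤ i → |(P.coeff i : ℝ)| ≤ B) → ∀ F : Finset Torus1,
      ∑ y ∈ F, ‖expMean M P y‖ ^ (2 * D * s : ℝ) ≤ K * B := by
  classical
  obtain ⟨K, hK, hbound⟩ := exists_sum_norm_expMean_rpow_le_of_primitive D hD s hs
  refine ⟨K, hK, fun M hM P hPD hP1 B hB F => ?_⟩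
  set g := P.divX.content with hg
  set R := P.divX.primPart with hR
  have hRp : R.IsPrimitive := P.divX.isPrimitive_primPart
  have hdec : P = C g * (R * X) + C (P.coeff 0) := by
    conv_lhs => rw [← divX_mul_X_add P, P.divX.eq_C_content_mul_primPart]
    rw [mul_assoc]
  clear_value g R
  have hcoeff : ∀ i, 1 ≤ i → P.coeff i = g * (R * X).coeff i := fun i hi => by
    conv_lhs => rw [hdec]
    rw [coeff_add, coeff_C_mul, coeff_C, if_neg (by omega), add_zero]
  have hlead : P.coeff P.natDegree ≠ 0 := by
    rw [coeff_natDegree, Ne, leadingCoeff_eq_zero]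
    rintro rfl
    simp at hP1
  have hg0 : g ≠ 0 := fun h => hlead (by rw [hcoeff _ hP1, h, zero_mul])
  have hgB : (g.natAbs : ℝ) ≤ B := by
    refine le_trans ?_ (hB _ hP1)
    rw [← Int.cast_abs, Int.abs_eq_natAbs, Int.cast_natCast]
    exact_mod_cast Nat.le_of_dvd (Int.natAbs_pos.2 hlead)
      (Int.natAbs_dvd_natAbs.2 ⟨_, hcoeff _ hP1⟩)
  have hRdeg : (R * X).natDegree ≤ D := by
    rw [natDegree_le_iff_coeff_eq_zero]
    intro i hi
    have h1 := hcoeff i (by omega)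
    rw [coeff_eq_zero_of_natDegree_lt (hPD.trans_lt hi)] at h1
    exact (mul_eq_zero.1 h1.symm).resolve_left hg0
  have hRprim : ∀ p : ℕ, p.Prime → ∃ i, 1 ≤ i ∧ ¬ (p : ℤ) ∣ (R * X).coeff i := fun p hp => by
    by_contra! hcon
    have h1 : C (p : ℤ) ∣ R := (C_dvd_iff_dvd_coeff _ _).2 fun i => by
      simpa using hcon (i + 1) (by omega)
    have h2 := hRp (p : ℤ) h1
    rw [Int.isUnit_iff] at h2
    have := hp.two_le
    omega
  have hmean : ∀ y, ‖expMean M P y‖ = ‖expMean M (R * X) (g • y)‖ := fun y => by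
    have h1 : expMean M P y = circ (P.coeff 0 • y) * expMean M (R * X) (g • y) := by
      unfold expMean
      rw [← smul_eq_mul, ← map_smul]
      congr 1
      ext n
      rw [Pi.smul_apply, smul_eq_mul, ← circ_add, smul_smul, ← add_smul]
      conv_lhs => rw [hdec]
      rw [eval_add, eval_mul, eval_C, eval_C, add_comm, mul_comm g]
    rw [h1, norm_mul, norm_circ, one_mul]
  have hfib : ∀ z, (F.filter fun y => g • y = z).card ≤ g.natAbs := fun z => by
    rcases (F.filter fun y => g • y = z).eq_empty_or_nonempty with h | ⟨y₀, hy₀⟩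
    · rw [h]; simp
    have h1 := AddCircle.card_torsion_le_of_isSMulRegular_int (1 : ℝ) g hg0
      (fun a b h => by simpa [hg0] using h)
    have h2 : (((F.filter fun y => g • y = z).image fun y => y - y₀ : Finset Torus1) :
        Set Torus1) ⊆ {x | g • x = 0} := fun w hw => by
      obtain ⟨y, hy, rfl⟩ := Finset.mem_image.1 hw
      simp only [Set.mem_ofPred_eq]
      rw [smul_sub, (Finset.mem_filter.1 hy).2, (Finset.mem_filter.1 hy₀).2, sub_self]
    have h3 := (Set.encard_le_encard h2).trans h1
    rw [Set.encard_coe_eq_coe_finsetCard,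
      Finset.card_image_of_injective _ (sub_left_injective)] at h3
    exact_mod_cast h3
  have hB0 : 0 ≤ B := (Nat.cast_nonneg _).trans hgB
  calc ∑ y ∈ F, ‖expMean M P y‖ ^ (2 * D * s : ℝ)
      = ∑ y ∈ F, ‖expMean M (R * X) (g • y)‖ ^ (2 * D * s : ℝ) := by simp only [hmean]
    _ = ∑ z ∈ F.image (g • ·), (F.filter fun y => g • y = z).card •
          ‖expMean M (R * X) z‖ ^ (2 * D * s : ℝ) :=
        Finset.sum_comp (fun z => ‖expMean M (R * X) z‖ ^ (2 * D * s : ℝ)) (g • ·)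
    _ ≤ ∑ z ∈ F.image (g • ·), B * ‖expMean M (R * X) z‖ ^ (2 * D * s : ℝ) := by
        refine Finset.sum_le_sum fun z _ => ?_
        rw [nsmul_eq_mul]
        gcongr
        exact le_trans (by exact_mod_cast hfib z) hgB
    _ = B * ∑ z ∈ F.image (g • ·), ‖expMean M (R * X) z‖ ^ (2 * D * s : ℝ) := by
        rw [Finset.mul_sum]
    _ ≤ B * K := by
        gcongr
        exact hbound M hM _ hRdeg hRprim _
    _ = K * B := mul_comm _ _

theorem exists_sum_norm_expMean_sub_le (D : ℕ) (hD : 0 < D) (s : ℝ) (hs : 1 < s) :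
    ∃ C : ℝ, 0 < C ∧ ∀ M : (ℕ → ℂ) →ₗ[ℂ] ℂ, IsInvMean M → ∀ P : ℤ[X], P.natDegree ≤ D →
      1 ≤ P.natDegree → ∀ B : ℝ, (∀ i, 1 ≤ i → |(P.coeff i : ℝ)| ≤ B) → ∀ X : Finset Torus1,
      ∑ x ∈ X, ∑ x' ∈ X, ‖expMean M P (x - x')‖ ≤
        C * (X.card : ℝ) ^ (2 - 1 / (2 * D * s)) * B ^ (1 / (2 * D * s)) := by
  classical
  obtain ⟨C, hC, hbound⟩ := exists_sum_norm_expMean_rpow_le D hD s hs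
  set r : ℝ := 2 * D * s with hr
  have hD1 : (1 : ℝ) ≤ D := by exact_mod_cast hD
  have hr1 : 1 ≤ r := by rw [hr]; nlinarith
  have hr0 : 0 < r := by linarith
  refine ⟨C ^ (1 / r), by positivity, fun M hM P hPD hP1 B hB X => ?_⟩
  have hB0 : 0 ≤ B := (abs_nonneg _).trans (hB _ hP1)
  rcases X.eq_empty_or_nonempty with rfl | hX
  · simp only [Finset.sum_empty]; positivity
  have hk : (0 : ℝ) < X.card := by exact_mod_cast hX.card_pos
  have hin : ∀ x ∈ X, ∑ x' ∈ X, ‖expMean M P (x - x')‖ ≤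
      (X.card : ℝ) ^ (1 - 1 / r) * C ^ (1 / r) * B ^ (1 / r) := fun x _ => by
    have h1 : ∑ x' ∈ X, ‖expMean M P (x - x')‖ ^ r ≤ C * B := by
      have h2 := hbound M hM P hPD hP1 B hB (X.image fun x' => x - x')
      rwa [Finset.sum_image (fun a _ b _ h => sub_right_injective h)] at h2
    have h3 := Real.rpow_sum_le_const_mul_sum_rpow X (fun x' => ‖expMean M P (x - x')‖) hr1
    simp only [abs_norm] at h3
    have h4 : (∑ x' ∈ X, ‖expMean M P (x - x')‖) ^ r ≤ (X.card : ℝ) ^ (r - 1) * (C * B) :=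
      h3.trans (by gcongr)
    have h5 := Real.rpow_le_rpow (by positivity) h4 (one_div_nonneg.2 hr0.le)
    rw [← Real.rpow_mul (by positivity), mul_one_div_cancel hr0.ne', Real.rpow_one,
      Real.mul_rpow (by positivity) (by positivity), Real.mul_rpow hC.le hB0,
      ← Real.rpow_mul hk.le] at h5
    rw [mul_assoc]
    convert h5 using 3
    field_simp
  refine (Finset.sum_le_card_nsmul _ _ _ hin).trans_eq ?_
  rw [nsmul_eq_mul, show (2 - 1 / r) = 1 + (1 - 1 / r) by ring, Real.rpow_add hk, Real.rpow_one]
  ring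

end Moments

section Fejer

/-- The Fourier coefficients of the `1`-periodic triangle function supported on `[-ε, ε]`. -/
noncomputable def triangleCoeff (ε : ℝ) (n : ℤ) : ℝ :=
  (if n = 0 then ε else 0) + (1 - Real.cos (2 * Real.pi * n * ε)) / (2 * Real.pi ^ 2 * ε) *
    (1 / (n : ℝ) ^ 2)

theorem circ_zsmul_coe (n : ℤ) (x : ℝ) :
    circ (n • (x : Torus1)) = Complex.exp (2 * Real.pi * Complex.I * n * x) := by
  have := fourier_coe_apply (T := (1 : ℝ)) (n := n) (x := x)
  rw [fourier_apply] at this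
  rw [circ, this]
  simp

theorem hasSum_circ_div_sq {x : ℝ} (hx : x ∈ Set.Icc (0 : ℝ) 1) :
    HasSum (fun n : ℤ => 1 / (n : ℂ) ^ 2 * circ (n • (x : Torus1)))
      ((2 * Real.pi ^ 2 * (x ^ 2 - x + 6⁻¹) : ℝ) : ℂ) := by
  have := hasSum_one_div_pow_mul_fourier_mul_bernoulliFun (k := 2) le_rfl hx
  rw [bernoulliFun_two] at this
  convert this using 1
  · simp only [fourier_apply, circ]
  · rw [mul_pow, Complex.I_sq]
    push_cast [Nat.factorial]
    ring

theorem circ_zsmul_add_circ_zsmul (n : ℤ) (x ε : ℝ) :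
    circ (n • ((x : Torus1) + (ε : Torus1))) + circ (n • ((x : Torus1) - (ε : Torus1))) =
      2 * Real.cos (2 * Real.pi * n * ε) * circ (n • (x : Torus1)) := by
  rw [← AddCircle.coe_add, ← AddCircle.coe_sub, circ_zsmul_coe, circ_zsmul_coe, circ_zsmul_coe,
    Complex.ofReal_cos, Complex.two_cos, add_mul, ← Complex.exp_add, ← Complex.exp_add]
  congr 2 <;> push_cast <;> ring

theorem hasSum_triangleCoeff {ε : ℝ} (hε : 0 < ε) {x y z : ℝ} (hx : x ∈ Set.Icc (0 : ℝ) 1)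
    (hy : y ∈ Set.Icc (0 : ℝ) 1) (hz : z ∈ Set.Icc (0 : ℝ) 1)
    (hxy : (y : Torus1) = (x : Torus1) + (ε : Torus1))
    (hxz : (z : Torus1) = (x : Torus1) - (ε : Torus1)) :
    HasSum (fun n : ℤ => (triangleCoeff ε n : ℂ) * circ (n • (x : Torus1)))
      ((ε + ((x ^ 2 - x) - ((y ^ 2 - y) + (z ^ 2 - z)) / 2) / ε : ℝ) : ℂ) := by
  have h0 : HasSum (fun n : ℤ => if n = 0 then (ε : ℂ) else 0) ε := hasSum_ite_eq 0 _
  have hE := ((hasSum_circ_div_sq hx).sub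
    (((hasSum_circ_div_sq hy).add (hasSum_circ_div_sq hz)).mul_left (1 / 2 : ℂ))).mul_left
    (1 / (2 * Real.pi ^ 2 * ε) : ℂ)
  have hε' : (ε : ℂ) ≠ 0 := by exact_mod_cast hε.ne'
  have hpi : (Real.pi : ℂ) ≠ 0 := by exact_mod_cast Real.pi_ne_zero
  convert h0.add hE using 1
  · ext n
    have h1 := circ_zsmul_add_circ_zsmul n x ε
    rw [← hxy, ← hxz] at h1
    rw [triangleCoeff, ← mul_add, h1]
    by_cases hn : n = 0
    · subst hn; simp
    · simp only [if_neg hn]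
      push_cast
      ring
  · push_cast
    field_simp
    ring

theorem triangleCoeff_nonneg {ε : ℝ} (hε : 0 < ε) (n : ℤ) : 0 ≤ triangleCoeff ε n := by
  have := Real.cos_le_one (2 * Real.pi * n * ε)
  refine add_nonneg (by split_ifs <;> linarith) (mul_nonneg (div_nonneg (by linarith) ?_) ?_) <;>
    positivity

theorem triangleCoeff_le {ε : ℝ} (hε : 0 < ε) {n : ℤ} (hn : n ≠ 0) :
    triangleCoeff ε n ≤ 1 / ε * (1 / (n : ℝ) ^ 2) := by
  have h1 := Real.neg_one_le_cos (2 * Real.pi * n * ε)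
  have h2 := Real.pi_gt_three
  rw [triangleCoeff, if_neg hn, zero_add]
  refine mul_le_mul_of_nonneg_right ?_ (by positivity)
  rw [div_le_div_iff₀ (by positivity) hε, one_mul]
  exact mul_le_mul_of_nonneg_right (by nlinarith) hε.le

theorem hasSum_triangleCoeff_zero {ε : ℝ} (hε : 0 < ε) (hε2 : ε < 1 / 2) :
    HasSum (triangleCoeff ε) 1 := by
  have := hasSum_triangleCoeff hε (x := 0) (y := ε) (z := 1 - ε) ⟨le_rfl, by linarith⟩
    ⟨by linarith, by linarith⟩ ⟨by linarith, by linarith⟩ (by simp)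
    (by rw [AddCircle.coe_sub, AddCircle.coe_period]; simp)
  rw [← Complex.hasSum_ofReal]
  convert this using 1
  · ext n; simp
  · congr 1
    field_simp
    ring

theorem hasSum_triangleCoeff_eq_zero {ε : ℝ} (hε : 0 < ε) {θ : Torus1} (hθ : ε < ‖θ‖) :
    HasSum (fun n : ℤ => (triangleCoeff ε n : ℂ) * circ (n • θ)) 0 := by
  obtain ⟨x, ⟨hx0, hx1⟩, rfl⟩ : ∃ x : ℝ, x ∈ Set.Ico (0 : ℝ) 1 ∧ (x : Torus1) = θ := by
    have := (AddCircle.coe_image_Ico_eq (1 : ℝ) 0).symm ▸ Set.mem_univ θ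
    simpa using this
  rw [UnitAddCircle.norm_eq] at hθ
  have h0 := hθ.trans_le (round_le x 0)
  have h1 := hθ.trans_le (round_le x 1)
  rw [Int.cast_zero, sub_zero, abs_of_nonneg hx0] at h0
  rw [Int.cast_one, abs_of_nonpos (by linarith)] at h1
  have := hasSum_triangleCoeff hε (x := x) (y := x + ε) (z := x - ε) ⟨hx0, hx1.le⟩
    ⟨by linarith, by linarith⟩ ⟨by linarith, by linarith⟩ (by simp) (by simp)
  convert this using 1
  rw [← Complex.ofReal_zero]
  congr 1
  field_simp
  ring

/-- A trigonometric polynomial with nonnegative coefficients which is almost zero away from a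
neighbourhood of the origin. -/
theorem exists_trig_kernel : ∃ Z : ℝ, 0 < Z ∧ ∀ ε : ℝ, 0 < ε → ε < 1 / 2 → ∀ δ : ℝ, 0 < δ →
    ∃ (S : Finset ℤ) (c : ℤ → ℝ), 0 ∈ S ∧ c 0 = ε ∧ (∀ n, 0 ≤ c n) ∧ ∑ n ∈ S, c n ≤ 1 ∧
      (∀ θ : Torus1, ε < ‖θ‖ → ‖∑ n ∈ S, (c n : ℂ) * circ (n • θ)‖ ≤ δ) ∧
      ∀ a : ℝ, 0 < a → a ≤ 1 / 2 → ∑ n ∈ S, c n * |(n : ℝ)| ^ a ≤ Z / ε := by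
  have hsum : Summable fun n : ℤ => |(n : ℝ)| ^ (-(3 / 2) : ℝ) :=
    Real.summable_abs_int_rpow (by norm_num)
  refine ⟨1 + ∑' n : ℤ, |(n : ℝ)| ^ (-(3 / 2) : ℝ), ?_, fun ε hε hε2 δ hδ => ?_⟩
  · have := tsum_nonneg (L := .unconditional ℤ) (g := fun n : ℤ => |(n : ℝ)| ^ (-(3 / 2) : ℝ))
      fun n => by positivity
    linarith
  have h1 := hasSum_triangleCoeff_zero hε hε2
  obtain ⟨S₀, hS₀⟩ := (Filter.Tendsto.eventually_const_lt
    (by linarith : 1 - δ < 1) h1).exists_forall_of_atTop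
  refine ⟨insert 0 S₀, triangleCoeff ε, by simp, by simp [triangleCoeff], triangleCoeff_nonneg hε,
    sum_le_hasSum _ (fun n _ => triangleCoeff_nonneg hε n) h1, fun θ hθ => ?_, fun a ha ha2 => ?_⟩
  · have hS := hS₀ _ (Finset.subset_insert 0 S₀)
    set S := insert 0 S₀
    have h2 := hasSum_triangleCoeff_eq_zero hε hθ
    have h3 : Filter.Tendsto (fun T : Finset ℤ => ‖∑ n ∈ T, (triangleCoeff ε n : ℂ) * circ (n • θ)
        - ∑ n ∈ S, (triangleCoeff ε n : ℂ) * circ (n • θ)‖) Filter.atTop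
        (nhds ‖0 - ∑ n ∈ S, (triangleCoeff ε n : ℂ) * circ (n • θ)‖) := (h2.sub_const _).norm
    rw [zero_sub, norm_neg] at h3
    refine le_of_tendsto h3 ?_
    filter_upwards [Filter.eventually_ge_atTop S] with T hT
    rw [← Finset.sum_sdiff hT, add_sub_cancel_right]
    refine (norm_sum_le_of_le _ (f := fun n => (triangleCoeff ε n : ℂ) * circ (n • θ))
      (n := fun n => triangleCoeff ε n) fun n _ => ?_).trans ?_
    · rw [norm_mul, norm_circ, mul_one, Complex.norm_real,
        Real.norm_of_nonneg (triangleCoeff_nonneg hε n)]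
    · have h4 := sum_le_hasSum T (fun n _ => triangleCoeff_nonneg hε n) h1
      rw [← Finset.sum_sdiff hT] at h4
      linarith
  · have h2 : ∀ n : ℤ, triangleCoeff ε n * |(n : ℝ)| ^ a ≤ 1 / ε * |(n : ℝ)| ^ (-(3 / 2) : ℝ) := by
      intro n
      by_cases hn : n = 0
      · subst hn
        rw [Int.cast_zero, abs_zero, Real.zero_rpow ha.ne']
        simp only [mul_zero]; positivity
      · have hn1 : (1 : ℝ) ≤ |(n : ℝ)| := by exact_mod_cast Int.one_le_abs hn
        have hn0 : (0 : ℝ) < |(n : ℝ)| := by linarith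
        calc triangleCoeff ε n * |(n : ℝ)| ^ a
            ≤ (1 / ε * (1 / (n : ℝ) ^ 2)) * |(n : ℝ)| ^ (1 / 2 : ℝ) := by
              gcongr
              exact triangleCoeff_le hε hn
          _ = 1 / ε * |(n : ℝ)| ^ (-(3 / 2) : ℝ) := by
              rw [← sq_abs, mul_assoc, one_div (|(n : ℝ)| ^ 2), ← Real.rpow_natCast,
                ← Real.rpow_neg hn0.le, ← Real.rpow_add hn0]
              norm_num
    calc _ ≤ ∑ n ∈ insert 0 S₀, 1 / ε * |(n : ℝ)| ^ (-(3 / 2) : ℝ) :=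
          Finset.sum_le_sum fun n _ => h2 n
      _ = 1 / ε * ∑ n ∈ insert 0 S₀, |(n : ℝ)| ^ (-(3 / 2) : ℝ) := by rw [Finset.mul_sum]
      _ ≤ 1 / ε * ∑' n : ℤ, |(n : ℝ)| ^ (-(3 / 2) : ℝ) := by
          gcongr
          exact hsum.sum_le_tsum _ fun n _ => by positivity
      _ ≤ _ := by
          rw [div_mul_eq_mul_div, one_mul]
          gcongr
          linarith

end Fejer

section Assembly

/-- A trigonometric polynomial in several variables with nonnegative coefficients which is almost
zero away from a box around the origin. -/
theorem exists_trig_kernel_pi (L : ℕ) : ∃ Z : ℝ, 0 < Z ∧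
    ∀ ε : ℝ, 0 < ε → ε < 1 / 2 → ∀ δ : ℝ, 0 < δ →
    ∃ (S : Finset (Fin L → ℤ)) (w : (Fin L → ℤ) → ℝ), 0 ∈ S ∧ w 0 = ε ^ L ∧ (∀ m, 0 ≤ w m) ∧
      ∑ m ∈ S, w m ≤ 1 ∧
      (∀ θ : Fin L → Torus1, (∃ l, ε < ‖θ l‖) →
        ‖∑ m ∈ S, (w m : ℂ) * circ (∑ l, m l • θ l)‖ ≤ δ) ∧
      ∀ a : ℝ, 0 < a → a ≤ 1 / 2 → ∑ m ∈ S, w m * ∑ l, |(m l : ℝ)| ^ a ≤ L * (Z / ε) := by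
  obtain ⟨Z, hZ, hker⟩ := exists_trig_kernel
  refine ⟨Z, hZ, fun ε hε hε2 δ hδ => ?_⟩
  obtain ⟨S, c, h0, hc0, hc, hc1, hsmall, hmom⟩ := hker ε hε hε2 δ hδ
  have hfac : ∀ g : Fin L → ℤ → ℝ, (∀ l n, 0 ≤ g l n) →
      ∑ m ∈ Fintype.piFinset (fun _ : Fin L => S), ∏ l, g l (m l) = ∏ l, ∑ n ∈ S, g l n :=
    fun g _ => (Finset.prod_univ_sum (fun _ : Fin L => S) g).symm
  refine ⟨Fintype.piFinset fun _ => S, fun m => ∏ l, c (m l), by simpa using fun _ => h0,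
    by simp [hc0], fun m => Finset.prod_nonneg fun l _ => hc _, ?_, ?_, ?_⟩
  · rw [hfac (fun _ => c) fun _ => hc]
    exact Finset.prod_le_one (fun _ _ => Finset.sum_nonneg fun n _ => hc n) fun _ _ => hc1
  · rintro θ ⟨l, hl⟩
    have h1 : ∑ m ∈ Fintype.piFinset (fun _ : Fin L => S),
        ((∏ l, c (m l) : ℝ) : ℂ) * circ (∑ l, m l • θ l) =
        ∏ l, ∑ n ∈ S, (c n : ℂ) * circ (n • θ l) := by
      rw [Finset.prod_univ_sum]
      refine Finset.sum_congr rfl fun m _ => ?_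
      rw [circ_sum, Finset.prod_mul_distrib, Complex.ofReal_prod]
    rw [h1, norm_prod, ← Finset.mul_prod_erase _ _ (Finset.mem_univ l)]
    refine (mul_le_of_le_one_right (norm_nonneg _) ?_).trans (hsmall _ hl)
    refine Finset.prod_le_one (fun _ _ => norm_nonneg _) fun j _ => ?_
    refine (norm_sum_le_of_le _ (n := c) fun n _ => ?_).trans hc1
    rw [norm_mul, norm_circ, mul_one, Complex.norm_real, Real.norm_of_nonneg (hc n)]
  · intro a ha ha2
    simp only [Finset.mul_sum]
    rw [Finset.sum_comm]
    refine (Finset.sum_le_card_nsmul Finset.univ _ (Z / ε) fun l _ => ?_).trans_eq (by simp)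
    have h1 : ∀ m : Fin L → ℤ, (∏ j, c (m j)) * |(m l : ℝ)| ^ a =
        ∏ j, (c (m j) * if j = l then |(m j : ℝ)| ^ a else 1) := fun m => by
      rw [Finset.prod_mul_distrib, Finset.prod_ite_eq' Finset.univ l]
      simp
    simp only [h1]
    rw [hfac (fun j n => c n * if j = l then |(n : ℝ)| ^ a else 1) fun j n =>
      mul_nonneg (hc n) (by split_ifs <;> positivity),
      ← Finset.mul_prod_erase _ _ (Finset.mem_univ l)]
    refine (mul_le_of_le_one_right ?_ ?_).trans ?_
    · exact Finset.sum_nonneg fun n _ => mul_nonneg (hc n) (by split_ifs <;> positivity)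
    · refine Finset.prod_le_one (fun j _ => Finset.sum_nonneg fun n _ =>
        mul_nonneg (hc n) (by split_ifs <;> positivity)) fun j hj => ?_
      simpa [(Finset.mem_erase.1 hj).1] using hc1
    · simpa using hmom a ha ha2

/-- The one-parameter closed subgroup of the torus with integer direction `v`. -/
def lineSubgroup {L : ℕ} (v : Fin L → ℤ) : AddSubgroup (Fin L → Torus1) :=
  (AddMonoidHom.mk' (fun (t : Torus1) l => v l • t) fun s t => by
    ext l; exact zsmul_add s t (v l)).range

theorem mem_lineSubgroup {L : ℕ} {v : Fin L → ℤ} {s : Fin L → Torus1} :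
    s ∈ lineSubgroup v ↔ ∃ t : Torus1, ∀ l, s l = v l • t := by
  rw [lineSubgroup, AddMonoidHom.mem_range]
  simp only [AddMonoidHom.mk'_apply, funext_iff, eq_comm]

theorem isSubtorus_lineSubgroup {L : ℕ} {v : Fin L → ℤ} (hv : v ≠ 0) :
    IsSubtorus (lineSubgroup v) := by
  have hrange : (lineSubgroup v : Set (Fin L → Torus1)) =
      Set.range fun (t : Torus1) l => v l • t := AddMonoidHom.coe_range _
  have hcont : Continuous fun (t : Torus1) (l : Fin L) => v l • t :=
    continuous_pi fun l => continuous_zsmul (v l)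
  refine ⟨?_, ?_, ?_⟩
  · rw [hrange]
    exact (isCompact_range hcont).isClosed
  · rw [hrange]
    exact isConnected_range hcont
  · intro hbot
    obtain ⟨l, hl⟩ := Function.ne_iff.1 hv
    have hl0 : (v l : ℝ) ≠ 0 := by exact_mod_cast hl
    have h1 : (fun j => v j • ((1 / (2 * v l) : ℝ) : Torus1)) ∈ lineSubgroup v :=
      mem_lineSubgroup.2 ⟨_, fun _ => rfl⟩
    rw [hbot, AddSubgroup.mem_bot] at h1
    have h2 := congrFun h1 l
    simp only [Pi.zero_apply, ← AddCircle.coe_zsmul] at h2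
    rw [zsmul_eq_mul, show (v l : ℝ) * (1 / (2 * v l)) = 1 / 2 by field_simp,
      AddCircle.coe_eq_zero_iff] at h2
    obtain ⟨n, hn⟩ := h2
    rw [zsmul_eq_mul, mul_one] at hn
    have h3 : (2 * n : ℝ) = 1 := by linarith
    have h4 : 2 * n = 1 := by exact_mod_cast h3
    omega

/-- If exponential sums are large for every positive `n`, then so are the corresponding
invariant means. -/
theorem sq_le_sum_norm_expMean {M : (ℕ → ℂ) →ₗ[ℂ] ℂ} (hM : IsInvMean M) {ι : Type*}
    (S : Finset ι) (w : ι → ℝ) (hw : ∀ m, 0 ≤ w m) (hw1 : ∑ m ∈ S, w m ≤ 1)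
    (p : ι → Polynomial ℤ) (X : Finset Torus1) (η : ℝ) (hη : 0 ≤ η)
    (h : ∀ n : ℕ, 0 < n → η ≤ ∑ m ∈ S, w m * ‖∑ x ∈ X, circ ((p m).eval (n : ℤ) • x)‖) :
    η ^ 2 ≤ ∑ m ∈ S, w m * ∑ x ∈ X, ∑ x' ∈ X, ‖expMean M (p m) (x - x')‖ := by
  set G : ℕ → ℂ := ∑ m ∈ S, (w m : ℂ) • ∑ x ∈ X, ∑ x' ∈ X,
    fun n : ℕ => circ ((p m).eval (n : ℤ) • (x - x')) with hG
  have hGn : ∀ n, G n = ∑ m ∈ S, (w m : ℂ) * ∑ x ∈ X, ∑ x' ∈ X,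
      circ ((p m).eval (n : ℤ) • (x - x')) := fun n => by simp [hG]
  have hsq : ∀ (n : ℕ) m, ∑ x ∈ X, ∑ x' ∈ X, circ ((p m).eval (n : ℤ) • (x - x')) =
      ((‖∑ x ∈ X, circ ((p m).eval (n : ℤ) • x)‖ ^ 2 : ℝ) : ℂ) := fun n m => by
    rw [← Complex.normSq_eq_norm_sq, ← Complex.mul_conj, map_sum, Finset.sum_mul_sum]
    refine Finset.sum_congr rfl fun x _ => Finset.sum_congr rfl fun x' _ => ?_
    rw [← Complex.star_def, star_circ, ← circ_add, smul_sub, sub_eq_add_neg]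
  have hGre : ∀ n, (G n).re = ∑ m ∈ S, w m * ‖∑ x ∈ X, circ ((p m).eval (n : ℤ) • x)‖ ^ 2 :=
    fun n => by
      rw [hGn, Complex.re_sum]
      refine Finset.sum_congr rfl fun m _ => ?_
      rw [hsq, ← Complex.ofReal_mul, Complex.ofReal_re]
  have hGbd : ∀ n, ‖G n‖ ≤ (X.card : ℝ) * X.card := fun n => by
    rw [hGn]
    refine (norm_sum_le_of_le _ (n := fun m => w m * ((X.card : ℝ) * X.card))
      fun m _ => ?_).trans ?_
    · rw [norm_mul, Complex.norm_real, Real.norm_of_nonneg (hw m)]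
      refine mul_le_mul_of_nonneg_left ?_ (hw m)
      refine (norm_sum_le_of_le _ (n := fun _ => (X.card : ℝ)) fun x _ => ?_).trans_eq (by simp)
      exact (norm_sum_le_of_le _ (n := fun _ => (1 : ℝ)) fun x _ => by simp).trans_eq (by simp)
    · rw [← Finset.sum_mul]
      exact mul_le_of_le_one_left (by positivity) hw1
  have h1 : ∀ n : ℕ, η ^ 2 ≤ (G (n + 1)).re := fun n => by
    rw [hGre]
    have h2 := Finset.sum_sq_le_sum_mul_sum_of_sq_le_mul S
      (r := fun m => w m * ‖∑ x ∈ X, circ ((p m).eval ((n + 1 : ℕ) : ℤ) • x)‖) (f := w)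
      (g := fun m => w m * ‖∑ x ∈ X, circ ((p m).eval ((n + 1 : ℕ) : ℤ) • x)‖ ^ 2)
      (fun m _ => hw m) (fun m _ => mul_nonneg (hw m) (by positivity))
      (fun m _ => (by ring : _ = _).le)
    refine (pow_le_pow_left₀ hη (h (n + 1) n.succ_pos) 2).trans (h2.trans ?_)
    exact mul_le_of_le_one_left (Finset.sum_nonneg fun m _ =>
      mul_nonneg (hw m) (by positivity)) hw1
  have h2 := hM.mono (fun n => G (n + 1)) (η ^ 2) _ (fun n => hGbd (n + 1)) h1
  rw [hM.shift_one G _ hGbd] at h2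
  refine h2.trans ((Complex.re_le_norm _).trans ?_)
  rw [hG, map_sum]
  refine norm_sum_le_of_le _ fun m _ => ?_
  rw [map_smul, norm_smul, Complex.norm_real, Real.norm_of_nonneg (hw m), map_sum]
  refine mul_le_mul_of_nonneg_left (norm_sum_le_of_le _ fun x _ => ?_) (hw m)
  rw [map_sum]
  exact norm_sum_le _ _

end Assembly

section Main

open Polynomial

variable {L D : ℕ}

/-- The integer polynomial `m ⬝ A(x)` attached to a row vector `m`. -/
noncomputable def dotPoly (A : Fin (D + 1) → Matrix (Fin L) (Fin 1) ℤ) (m : Fin L → ℤ) : ℤ[X] :=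
  ∑ d : Fin (D + 1), C (∑ l, m l * A d l 0) * X ^ (d : ℕ)

theorem coeff_dotPoly (A : Fin (D + 1) → Matrix (Fin L) (Fin 1) ℤ) (m : Fin L → ℤ)
    (d : Fin (D + 1)) : (dotPoly A m).coeff d = ∑ l, m l * A d l 0 := by
  simp only [dotPoly, finsetSum_coeff, coeff_C_mul_X_pow, Fin.val_inj]
  simp

theorem natDegree_dotPoly_le (A : Fin (D + 1) → Matrix (Fin L) (Fin 1) ℤ) (m : Fin L → ℤ) :
    (dotPoly A m).natDegree ≤ D :=
  natDegree_sum_le_of_forall_le _ _ fun d _ =>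
    (natDegree_C_mul_X_pow_le _ _).trans (Nat.lt_succ_iff.1 d.2)

theorem eval_dotPoly (A : Fin (D + 1) → Matrix (Fin L) (Fin 1) ℤ) (m : Fin L → ℤ) (n : ℤ) :
    (dotPoly A m).eval n = ∑ l, m l * evalMat A n l 0 := by
  simp only [dotPoly, eval_finsetSum, eval_mul, eval_C, eval_pow, eval_X, evalMat,
    Matrix.sum_apply, Matrix.smul_apply, smul_eq_mul, Finset.mul_sum, Finset.sum_mul]
  rw [Finset.sum_comm]
  exact Finset.sum_congr rfl fun l _ => Finset.sum_congr rfl fun d _ => by ring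

theorem natAbs_le_starNorm (A : Fin (D + 1) → Matrix (Fin L) (Fin 1) ℤ) {d : Fin (D + 1)}
    (hd : d ≠ 0) (l : Fin L) : (A d l 0).natAbs ≤ starNorm A := by
  have h1 : (A d l 0).natAbs ≤
      Finset.univ.sup fun p : Fin L × Fin 1 => (A d p.1 p.2).natAbs :=
    Finset.le_sup (f := fun p : Fin L × Fin 1 => (A d p.1 p.2).natAbs) (Finset.mem_univ (l, 0))
  exact h1.trans (Finset.le_sup
    (f := fun d => Finset.univ.sup fun p : Fin L × Fin 1 => (A d p.1 p.2).natAbs)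
    (by simpa using hd))

theorem abs_coeff_dotPoly_le (A : Fin (D + 1) → Matrix (Fin L) (Fin 1) ℤ) (m : Fin L → ℤ)
    {i : ℕ} (hi : 1 ≤ i) :
    |((dotPoly A m).coeff i : ℝ)| ≤ starNorm A * ∑ l, |(m l : ℝ)| := by
  rcases Nat.lt_or_ge D i with h | h
  · rw [coeff_eq_zero_of_natDegree_lt ((natDegree_dotPoly_le A m).trans_lt h), Int.cast_zero,
      abs_zero]
    positivity
  · have hd : (⟨i, by omega⟩ : Fin (D + 1)) ≠ 0 := by
      rw [Ne, Fin.ext_iff]; simp; omega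
    have h1 := coeff_dotPoly A m ⟨i, by omega⟩
    simp only at h1
    rw [h1, Int.cast_sum, Finset.mul_sum]
    refine (Finset.abs_sum_le_sum_abs _ _).trans (Finset.sum_le_sum fun l _ => ?_)
    rw [Int.cast_mul, abs_mul, mul_comm]
    refine mul_le_mul_of_nonneg_right ?_ (abs_nonneg _)
    have h2 := natAbs_le_starNorm A hd l
    rw [← Int.cast_abs, ← Int.natCast_natAbs]
    exact_mod_cast h2

/-- Condition (b) forces `m ⬝ A(x)` to vanish as soon as its non-constant part does. -/
theorem dotPoly_eq_zero {A : Fin (D + 1) → Matrix (Fin L) (Fin 1) ℤ} (hB : CondB A)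
    {m : Fin L → ℤ} (hm : ∀ d : Fin (D + 1), d ≠ 0 → ∑ l, m l * A d l 0 = 0) :
    dotPoly A m = 0 := by
  have hcast : ∀ d : Fin (D + 1), (fun l => (m l : ℚ)) ⬝ᵥ
      ((A d).map ((↑) : ℤ → ℚ)).mulVec (fun _ => 1) = ((∑ l, m l * A d l 0 : ℤ) : ℚ) := fun d => by
    simp [dotProduct, mulVec]
  have h0 := hB (fun l => (m l : ℚ)) (fun _ => 1) fun d hd => by rw [hcast, hm d hd, Int.cast_zero]
  rw [hcast] at h0
  refine Finset.sum_eq_zero fun d _ => ?_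
  have h1 : ∑ l, m l * A d l 0 = 0 := by
    by_cases hd : d = 0
    · subst hd; exact_mod_cast h0
    · exact hm d hd
  rw [h1, C_0, zero_mul]

theorem one_le_natDegree_dotPoly {A : Fin (D + 1) → Matrix (Fin L) (Fin 1) ℤ} {m : Fin L → ℤ}
    (hm : ¬ ∀ d : Fin (D + 1), d ≠ 0 → ∑ l, m l * A d l 0 = 0) :
    1 ≤ (dotPoly A m).natDegree := by
  push Not at hm
  obtain ⟨d, hd, hne⟩ := hm
  rw [← coeff_dotPoly] at hne
  exact (Nat.one_le_iff_ne_zero.2 fun h => hd (Fin.ext h)).trans (le_natDegree_of_ne_zero hne)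

theorem torusAct_evalMat (A : Fin (D + 1) → Matrix (Fin L) (Fin 1) ℤ) (n : ℤ) (x : Torus1)
    (l : Fin L) : torusAct (evalMat A n) (fun _ => x) l = evalMat A n l 0 • x := by
  simp [torusAct]

open Classical in
/-- If a dilate of `X` misses the box of radius `ε` around a point `s` of a line subgroup, the
frequencies not annihilating the non-constant part carry a large exponential sum. -/
theorem le_sum_norm_of_not_close {A : Fin (D + 1) → Matrix (Fin L) (Fin 1) ℤ} (hB : CondB A)
    {d₀ : Fin (D + 1)} (hd₀ : d₀ ≠ 0) {s : Fin L → Torus1}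
    (hs : s ∈ lineSubgroup fun l => A d₀ l 0) {ε δ : ℝ}
    {S : Finset (Fin L → ℤ)} {w : (Fin L → ℤ) → ℝ} (h0 : 0 ∈ S) (hw0 : w 0 = ε ^ L)
    (hw : ∀ m, 0 ≤ w m)
    (hker : ∀ θ : Fin L → Torus1, (∃ l, ε < ‖θ l‖) →
      ‖∑ m ∈ S, (w m : ℂ) * circ (∑ l, m l • θ l)‖ ≤ δ)
    (X : Finset Torus1) (n : ℤ) (hn : ∀ x ∈ X, ∃ l, ε < ‖evalMat A n l 0 • x - s l‖) :
    (ε ^ L - δ) * X.card ≤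
      ∑ m ∈ S with ¬ ∀ d : Fin (D + 1), d ≠ 0 → ∑ l, m l * A d l 0 = 0,
        w m * ‖∑ x ∈ X, circ ((dotPoly A m).eval n • x)‖ := by
  set triv : (Fin L → ℤ) → Prop := fun m => ∀ d : Fin (D + 1), d ≠ 0 → ∑ l, m l * A d l 0 = 0
    with htriv
  obtain ⟨t, ht⟩ := mem_lineSubgroup.1 hs
  have hms : ∀ m : Fin L → ℤ, ∑ l, m l • s l = (∑ l, m l * A d₀ l 0) • t := fun m => by
    simp only [ht, smul_smul, Finset.sum_smul]
  set F : (Fin L → ℤ) → ℂ := fun m =>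
    (w m : ℂ) * (circ (-∑ l, m l • s l) * ∑ x ∈ X, circ ((dotPoly A m).eval n • x)) with hF
  have hFsum : ∑ m ∈ S, F m =
      ∑ x ∈ X, ∑ m ∈ S, (w m : ℂ) * circ (∑ l, m l • (evalMat A n l 0 • x - s l)) := by
    rw [Finset.sum_comm]
    refine Finset.sum_congr rfl fun m _ => ?_
    simp only [hF]
    rw [← Finset.mul_sum, Finset.mul_sum X]
    congr 1
    refine Finset.sum_congr rfl fun x _ => ?_
    rw [← circ_add, eval_dotPoly, Finset.sum_smul]
    simp only [smul_sub, Finset.sum_sub_distrib, mul_smul]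
    congr 1
    abel
  have h1 : ‖∑ m ∈ S, F m‖ ≤ δ * X.card := by
    rw [hFsum]
    exact (norm_sum_le_of_le _ fun x hx => hker _ (hn x hx)).trans_eq (by simp [mul_comm])
  have h2 : ∀ m, triv m → F m = ((w m * X.card : ℝ) : ℂ) := fun m hm => by
    simp [hF, hms, hm d₀ hd₀, dotPoly_eq_zero hB hm]
  have h3 : ε ^ L * X.card ≤ ‖∑ m ∈ S with triv m, F m‖ := by
    rw [Finset.sum_congr rfl fun m hm => h2 m (Finset.mem_filter.1 hm).2, ← Complex.ofReal_sum,
      Complex.norm_real, Real.norm_of_nonneg (Finset.sum_nonneg fun m _ =>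
        mul_nonneg (hw m) (Nat.cast_nonneg _)), ← hw0]
    exact Finset.single_le_sum (f := fun m => w m * (X.card : ℝ))
      (fun m _ => mul_nonneg (hw m) (Nat.cast_nonneg _))
      (Finset.mem_filter.2 ⟨h0, fun d _ => by simp⟩)
  have h4 : ‖∑ m ∈ S with ¬ triv m, F m‖ ≤
      ∑ m ∈ S with ¬ triv m, w m * ‖∑ x ∈ X, circ ((dotPoly A m).eval n • x)‖ :=
    norm_sum_le_of_le _ fun m _ => by
      rw [hF, norm_mul, norm_mul, norm_circ, one_mul, Complex.norm_real,
        Real.norm_of_nonneg (hw m)]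
  have h5 := Finset.sum_filter_add_sum_filter_not S triv F
  have h6 : ‖∑ m ∈ S with triv m, F m‖ ≤
      ‖∑ m ∈ S, F m‖ + ‖∑ m ∈ S with ¬ triv m, F m‖ := by
    rw [← h5]
    simpa using norm_sub_le (∑ m ∈ S with triv m, F m + ∑ m ∈ S with ¬ triv m, F m)
      (∑ m ∈ S with ¬ triv m, F m)
  linarith

theorem rpow_sum_le_sum_rpow {ι : Type*} (s : Finset ι) (f : ι → ℝ) (hf : ∀ i, 0 ≤ f i) {a : ℝ}
    (ha : 0 < a) (ha1 : a ≤ 1) : (∑ i ∈ s, f i) ^ a ≤ ∑ i ∈ s, f i ^ a := by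
  classical
  induction s using Finset.induction_on with
  | empty => simp [Real.zero_rpow ha.ne']
  | insert i s hi ih =>
    rw [Finset.sum_insert hi, Finset.sum_insert hi]
    exact (Real.rpow_add_le_add_rpow (hf i) (Finset.sum_nonneg fun j _ => hf j) ha.le ha1).trans
      (by gcongr)

end Main

/-- **Base case of the effective theorem (`N = 1`).** Let `A(x) ∈ M_{L×1}(ℤ[x])` have
degree at most `D`, nonzero non-constant part, and satisfy condition (b). There is a
constant `C` depending only on `L` and `D` such that if `X ⊆ 𝕋` is a set of `k` distinct
points with no dilation `A(n) X` (`n ≥ 1`) being `ε`-dense in any translate of any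
subtorus of `𝕋^L`, then `k ≤ C ‖A_*‖_∞^{4D(L(L+1)+1)} (1/ε)^{4D(L+1)}`. -/
theorem statement6 (L D : ℕ) (hL : 0 < L) (hD : 0 < D) :
    ∃ C : ℝ, 0 < C ∧
      ∀ A : Fin (D + 1) → Matrix (Fin L) (Fin 1) ℤ,
        (∃ d : Fin (D + 1), d ≠ 0 ∧ A d ≠ 0) → CondB A →
        ∀ ε : ℝ, 0 < ε →
          ∀ X : Finset Torus1,
            (∀ n : ℕ, 0 < n → ∀ T : AddSubgroup (Fin L → Torus1), IsSubtorus T →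
              ∀ t : Fin L → Torus1,
                ¬ EpsDenseIn
                    (torusAct (evalMat A n) ''
                      ((fun x : Torus1 => fun _ : Fin 1 => x) '' (X : Set Torus1)))
                    (translateOf t T) ε) →
            (X.card : ℝ) ≤
              C * (starNorm A : ℝ) ^ (4 * D * (L * (L + 1) + 1)) *
                (1 / ε) ^ (4 * D * (L + 1)) := by
  classical
  have hL0 : (0 : ℝ) < L := by exact_mod_cast hL
  have hD0 : (1 : ℝ) ≤ D := by exact_mod_cast hD
  set s : ℝ := 1 + 1 / (2 * L + 1) with hs
  have hs1 : 1 < s := by rw [hs]; linarith [show (0 : ℝ) < 1 / (2 * L + 1) by positivity]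
  set r : ℝ := 2 * D * s with hr
  have hr2 : 2 ≤ r := by rw [hr]; nlinarith
  have hr0 : 0 < r := by linarith
  have hrL : (2 * L + 1) * r = 4 * D * (L + 1) := by
    rw [hr, hs]; field_simp; ring
  obtain ⟨C, hC, hsum⟩ := exists_sum_norm_expMean_sub_le D hD s hs1
  obtain ⟨Z, hZ, hker⟩ := exists_trig_kernel_pi L
  obtain ⟨M, hM⟩ := exists_isInvMean
  refine ⟨(4 * C * (L * Z)) ^ r, by positivity, fun A hA hB ε hε X hX => ?_⟩
  rcases X.eq_empty_or_nonempty with rfl | hXne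
  · simp only [Finset.card_empty, Nat.cast_zero]; positivity
  have hk : (0 : ℝ) < X.card := by exact_mod_cast hXne.card_pos
  obtain ⟨d₀, hd₀, hAd⟩ := hA
  have hv : (fun l => A d₀ l 0) ≠ 0 := fun h => hAd <| by
    ext l j
    rw [Subsingleton.elim j 0]
    exact congrFun h l
  have hH : 1 ≤ starNorm A := by
    obtain ⟨l, hl⟩ := Function.ne_iff.1 hv
    exact (Int.natAbs_pos.2 hl).trans_le (natAbs_le_starNorm A hd₀ l)
  have hfar : ∀ n : ℕ, 0 < n → ∃ p ∈ lineSubgroup fun l => A d₀ l 0,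
      ∀ x ∈ X, ∃ l, ε < ‖evalMat A n l 0 • x - p l‖ := fun n hn => by
    have h1 := hX n hn _ (isSubtorus_lineSubgroup hv) 0
    simp only [EpsDenseIn, translateOf, Set.forall_mem_image, Set.exists_mem_image, zero_add,
      torusAct_evalMat, dist_eq_norm] at h1
    push Not at h1
    simpa using h1
  have hε2 : ε < 1 / 2 := by
    obtain ⟨p, -, hp⟩ := hfar 1 one_pos
    obtain ⟨x, hx⟩ := hXne
    obtain ⟨l, hl⟩ := hp x hx
    have h1 := hl.trans_le (AddCircle.norm_le_half_period (1 : ℝ) one_ne_zero)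
    rwa [abs_one] at h1
  obtain ⟨S, w, h0, hw0, hw, hw1, hsmall, hmom⟩ :=
    hker ε hε hε2 (ε ^ L / 2) (by positivity)
  set S' := S.filter fun m => ¬ ∀ d : Fin (D + 1), d ≠ 0 → ∑ l, m l * A d l 0 = 0 with hS'
  have hmean := sq_le_sum_norm_expMean hM S' w hw
    ((Finset.sum_le_sum_of_subset_of_nonneg (Finset.filter_subset _ _)
      fun m _ _ => hw m).trans hw1) (dotPoly A) X (ε ^ L / 2 * X.card) (by positivity)
    fun n hn => by
      obtain ⟨p, hpT, hp⟩ := hfar n hn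
      have h1 := le_sum_norm_of_not_close hB hd₀ hpT h0 hw0 hw hsmall X n hp
      rwa [sub_half] at h1
  set H : ℝ := (starNorm A : ℝ) with hHdef
  have hH1 : 1 ≤ H := Nat.one_le_cast.2 hH
  have hH0 : 0 < H := by linarith
  have hr_inv : 1 / r ≤ 1 / 2 := one_div_le_one_div_of_le two_pos hr2
  have hbound : (ε ^ L / 2 * X.card) ^ 2 ≤
      C * (X.card : ℝ) ^ (2 - 1 / r) * H ^ (1 / r) * (L * (Z / ε)) := by
    calc (ε ^ L / 2 * X.card) ^ 2
        ≤ ∑ m ∈ S', w m * (C * (X.card : ℝ) ^ (2 - 1 / r) * H ^ (1 / r) *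
            ∑ l, |(m l : ℝ)| ^ (1 / r)) := by
          refine hmean.trans (Finset.sum_le_sum fun m hm => mul_le_mul_of_nonneg_left ?_ (hw m))
          refine (hsum M hM (dotPoly A m) (natDegree_dotPoly_le A m)
            (one_le_natDegree_dotPoly (Finset.mem_filter.1 hm).2) (H * ∑ l, |(m l : ℝ)|)
            (fun i hi => abs_coeff_dotPoly_le A m hi) X).trans ?_
          rw [Real.mul_rpow hH0.le (by positivity), ← mul_assoc]
          gcongr
          exact rpow_sum_le_sum_rpow _ _ (fun _ => abs_nonneg _) (by positivity) (by linarith)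
      _ ≤ ∑ m ∈ S, w m * (C * (X.card : ℝ) ^ (2 - 1 / r) * H ^ (1 / r) *
            ∑ l, |(m l : ℝ)| ^ (1 / r)) :=
          Finset.sum_le_sum_of_subset_of_nonneg (Finset.filter_subset _ _) fun m _ _ =>
            mul_nonneg (hw m) (by positivity)
      _ = C * (X.card : ℝ) ^ (2 - 1 / r) * H ^ (1 / r) *
            ∑ m ∈ S, w m * ∑ l, |(m l : ℝ)| ^ (1 / r) := by
          rw [Finset.mul_sum]
          exact Finset.sum_congr rfl fun m _ => by ring
      _ ≤ _ := by
          gcongr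
          exact hmom _ (by positivity) hr_inv
  have hroot : (X.card : ℝ) ^ (1 / r) ≤
      4 * C * (L * Z) * H ^ (1 / r) * (1 / ε) ^ (2 * L + 1) := by
    have hk2 : (X.card : ℝ) ^ 2 = (X.card : ℝ) ^ (2 - 1 / r) * (X.card : ℝ) ^ (1 / r) := by
      rw [← Real.rpow_add hk, sub_add_cancel]; norm_num
    have hk3 : 0 < (X.card : ℝ) ^ (2 - 1 / r) := by positivity
    rw [mul_pow, hk2] at hbound
    rw [_root_.one_div_pow, mul_one_div, le_div_iff₀ (by positivity)]
    refine le_of_mul_le_mul_left ?_ hk3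
    have h1 := mul_le_mul_of_nonneg_left hbound (show 0 ≤ 4 * ε by positivity)
    calc _ = 4 * ε * ((ε ^ L / 2) ^ 2 * ((X.card : ℝ) ^ (2 - 1 / r) * (X.card : ℝ) ^ (1 / r))) := by
          ring
      _ ≤ _ := h1
      _ = _ := by field_simp
  have hfin := Real.rpow_le_rpow (by positivity) hroot hr0.le
  rw [← Real.rpow_mul hk.le, one_div_mul_cancel hr0.ne', Real.rpow_one,
    Real.mul_rpow (by positivity) (by positivity), Real.mul_rpow (by positivity) (by positivity),
    ← Real.rpow_mul hH0.le, one_div_mul_cancel hr0.ne', Real.rpow_one, ← Real.rpow_natCast,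
    ← Real.rpow_mul (by positivity)] at hfin
  have hexp : ((2 * L + 1 : ℕ) : ℝ) * r = ((4 * D * (L + 1) : ℕ) : ℝ) := by
    push_cast; exact hrL
  rw [hexp, Real.rpow_natCast] at hfin
  refine hfin.trans ?_
  gcongr
  exact le_self_pow₀ hH1 (by positivity)
end

section
/- Let ε > 0, let X be an infinite subset of 𝕋^N, and let B(x) ∈ M_{ℓ×N}(ℤ[x]) be such that the rows of its non-constant part B_*(x) are ℚ-linearly independent (B_* has full rank ℓ). If B(r)X = {B(r)x : x ∈ X} is not ε-dense in 𝕋^ℓ for any integer r, then there exist a point y_0 ∈ X, an integer J, and a nonzero vector w ∈ ℤ^N such that w·(y − y_0) = J (an equality of real numbers, identifying points of 𝕋^N with their representatives in [0,1)^N) for infinitely many y ∈ X. -/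
open scoped BigOperators
open Matrix

/-- The unique representative in `[0,1)` of a point of `𝕋 = ℝ/ℤ`. -/
noncomputable def rep (x : Torus1) : ℝ :=
  haveI : Fact ((0 : ℝ) < 1) := ⟨zero_lt_one⟩
  ((AddCircle.equivIco 1 0) x : ℝ)


/-- The rows of the non-constant part `B_*(x)`, viewed as rational vectors obtained by
concatenating the coefficient matrices `B 1, …, B D`. -/
def starRows {L N D : ℕ} (A : Fin (D + 1) → Matrix (Fin L) (Fin N) ℤ) :
    Fin L → (Fin D × Fin N → ℚ) :=
  fun i p => ((A p.1.succ i p.2 : ℤ) : ℚ)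


section WeylSums

open Filter Topology Finset Polynomial

/-- The standard additive character `x ↦ exp (2πix)` of `ℝ/ℤ`, with complex values. -/
noncomputable def torusChar (x : Torus1) : ℂ := (AddCircle.toCircle x : ℂ)

lemma torusChar_add (x y : Torus1) : torusChar (x + y) = torusChar x * torusChar y := by
  simp [torusChar, AddCircle.toCircle_add]

@[simp] lemma torusChar_zero : torusChar 0 = 1 := by simp [torusChar]

@[simp] lemma norm_torusChar (x : Torus1) : ‖torusChar x‖ = 1 :=
  Circle.norm_coe _

lemma torusChar_neg (x : Torus1) : torusChar (-x) = (starRingEnd ℂ) (torusChar x) := by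
  rw [torusChar, AddCircle.toCircle_neg, Circle.coe_inv_eq_conj, torusChar]

lemma torusChar_sub (x y : Torus1) :
    torusChar (x - y) = torusChar x * (starRingEnd ℂ) (torusChar y) := by
  rw [sub_eq_add_neg, torusChar_add, torusChar_neg]

lemma torusChar_sum {ι : Type*} (s : Finset ι) (f : ι → Torus1) :
    torusChar (∑ i ∈ s, f i) = ∏ i ∈ s, torusChar (f i) := by
  classical
  induction s using Finset.induction_on with
  | empty => simp
  | insert a s ha ih => rw [sum_insert ha, prod_insert ha, torusChar_add, ih]

lemma torusChar_eq_one_iff {x : Torus1} : torusChar x = 1 ↔ x = 0 := by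
  constructor
  · intro h
    apply AddCircle.injective_toCircle (T := 1) one_ne_zero
    rw [AddCircle.toCircle_zero]
    exact Circle.ext (by simpa [torusChar] using h)
  · rintro rfl
    simp

/-- The average of the first `M` terms of a sequence. -/
noncomputable def avg (M : ℕ) (f : ℕ → ℂ) : ℂ := (M : ℂ)⁻¹ * ∑ n ∈ range M, f n

lemma avg_sum {ι : Type*} (M : ℕ) (s : Finset ι) (f : ι → ℕ → ℂ) :
    avg M (fun n => ∑ i ∈ s, f i n) = ∑ i ∈ s, avg M (f i) := by
  simp only [avg]
  rw [sum_comm, mul_sum]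

lemma avg_mul_left (M : ℕ) (c : ℂ) (f : ℕ → ℂ) : avg M (fun n => c * f n) = c * avg M f := by
  simp only [avg, ← mul_sum]
  ring

lemma norm_avg_le {M : ℕ} {f : ℕ → ℂ} (hf : ∀ n, ‖f n‖ ≤ 1) : ‖avg M f‖ ≤ 1 := by
  rcases Nat.eq_zero_or_pos M with rfl | hM
  · simp [avg]
  have hM' : (0 : ℝ) < M := by exact_mod_cast hM
  rw [avg, norm_mul, norm_inv, Complex.norm_natCast, inv_mul_le_iff₀ hM', mul_one]
  calc ‖∑ n ∈ range M, f n‖ ≤ ∑ n ∈ range M, ‖f n‖ := norm_sum_le _ _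
    _ ≤ ∑ n ∈ range M, (1 : ℝ) := sum_le_sum fun n _ => hf n
    _ = M := by simp

lemma norm_avg_shift_sub_avg_le {M : ℕ} {f : ℕ → ℂ} (hf : ∀ n, ‖f n‖ ≤ 1) (h : ℕ) :
    ‖avg M (fun n => f (n + h)) - avg M f‖ ≤ 2 * h / M := by
  have key : ∑ n ∈ range M, f (n + h) - ∑ n ∈ range M, f n
      = ∑ n ∈ range h, f (M + n) - ∑ n ∈ range h, f n := by
    have h1 := sum_range_add f M h
    have h2 := sum_range_add f h M
    rw [add_comm M h, h2] at h1
    have h3 : ∑ n ∈ range M, f (n + h) = ∑ n ∈ range M, f (h + n) :=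
      sum_congr rfl fun n _ => by rw [add_comm]
    rw [h3]
    linear_combination h1
  have hb : ∀ g : ℕ → ℂ, (∀ n, ‖g n‖ ≤ 1) → ‖∑ n ∈ range h, g n‖ ≤ h := fun g hg =>
    calc ‖∑ n ∈ range h, g n‖ ≤ ∑ n ∈ range h, ‖g n‖ := norm_sum_le _ _
      _ ≤ ∑ n ∈ range h, (1 : ℝ) := sum_le_sum fun n _ => hg n
      _ = h := by simp
  rw [avg, avg, ← mul_sub, key, norm_mul, norm_inv, Complex.norm_natCast, div_eq_inv_mul]
  gcongr
  calc _ ≤ _ := norm_sub_le _ _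
    _ ≤ h + h := add_le_add (hb _ fun n => hf _) (hb _ hf)
    _ = 2 * h := by ring

/-- Second moment bound: if the phases `p i` are pairwise nearly uncorrelated on average, then
the mean square of their normalised exponential sum is small. -/
lemma avg_normSq_sum_le {M k : ℕ} (hk : 0 < k) (p : ℕ → ℕ → Torus1) {δ : ℝ}
    (hδ : 0 ≤ δ)
    (h : ∀ i < k, ∀ j < k, i ≠ j → ‖avg M (fun n => torusChar (p i n - p j n))‖ ≤ δ) :
    (M : ℝ)⁻¹ * ∑ n ∈ range M, ‖(k : ℂ)⁻¹ * ∑ i ∈ range k, torusChar (p i n)‖ ^ 2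
      ≤ (k : ℝ)⁻¹ + δ := by
  have hk' : (0 : ℝ) < k := by exact_mod_cast hk
  have expand : (((M : ℝ)⁻¹ * ∑ n ∈ range M,
      ‖(k : ℂ)⁻¹ * ∑ i ∈ range k, torusChar (p i n)‖ ^ 2 : ℝ) : ℂ)
      = ((k : ℂ)⁻¹ ^ 2) * ∑ i ∈ range k, ∑ j ∈ range k,
        avg M (fun n => torusChar (p i n - p j n)) := by
    simp_rw [← avg_sum, ← avg_mul_left, avg]
    push_cast
    congr 1
    refine sum_congr rfl fun n _ => ?_
    rw [← Complex.mul_conj']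
    simp only [torusChar_sub, map_mul, map_sum, map_inv₀, Complex.conj_natCast, ← sum_mul_sum]
    ring
  have bound : ∀ i ∈ range k, ∀ j ∈ range k,
      ‖avg M (fun n => torusChar (p i n - p j n))‖ ≤ (if i = j then 1 else 0) + δ := by
    intro i hi j hj
    split_ifs with hij
    · have := norm_avg_le (M := M) (f := fun n => torusChar (p i n - p j n))
        fun n => (norm_torusChar _).le
      linarith
    · simpa using h i (mem_range.1 hi) j (mem_range.1 hj) hij
  calc _ ≤ ‖(((M : ℝ)⁻¹ * ∑ n ∈ range M,
      ‖(k : ℂ)⁻¹ * ∑ i ∈ range k, torusChar (p i n)‖ ^ 2 : ℝ) : ℂ)‖ := by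
        rw [Complex.norm_real]
        exact le_abs_self _
    _ ≤ (k : ℝ)⁻¹ ^ 2 * ∑ i ∈ range k, ∑ j ∈ range k, ((if i = j then 1 else 0) + δ) := by
        rw [expand, norm_mul, norm_pow, norm_inv, Complex.norm_natCast]
        gcongr
        refine (norm_sum_le _ _).trans (sum_le_sum fun i hi => ?_)
        exact (norm_sum_le _ _).trans (sum_le_sum fun j hj => bound i hi j hj)
    _ = (k : ℝ)⁻¹ + δ := by
        have : ∀ i ∈ range k, ∑ j ∈ range k, ((if i = j then (1 : ℝ) else 0) + δ) = 1 + k * δ := by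
          intro i hi
          rw [sum_add_distrib, sum_ite_eq, if_pos hi]
          simp
        rw [sum_congr rfl this]
        simp
        field_simp

/-- `IsPhasePoly d β p` says that `p : ℕ → ℝ/ℤ` is a polynomial phase of degree at most `d` whose
`d`-th iterated difference (with unit steps) is the constant `β`. -/
def IsPhasePoly : ℕ → Torus1 → (ℕ → Torus1) → Prop
  | 0, β, p => ∀ n, p n = β
  | d + 1, β, p => ∀ i j : ℕ,
      IsPhasePoly d (((i : ℤ) - (j : ℤ)) • β) (fun n => p (n + i) - p (n + j))

lemma IsPhasePoly.zero (d : ℕ) : IsPhasePoly d 0 (fun _ => 0) := by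
  induction d with
  | zero => intro n; rfl
  | succ d ih => intro i j; simpa using ih

lemma IsPhasePoly.add {d : ℕ} {β γ : Torus1} {p q : ℕ → Torus1} (hp : IsPhasePoly d β p)
    (hq : IsPhasePoly d γ q) : IsPhasePoly d (β + γ) (fun n => p n + q n) := by
  induction d generalizing β γ p q with
  | zero => intro n; simp [hp n, hq n]
  | succ d ih =>
    intro i j
    have := ih (hp i j) (hq i j)
    rw [← smul_add] at this
    convert this using 2
    exact add_sub_add_comm _ _ _ _

lemma IsPhasePoly.sum {ι : Type*} {d : ℕ} (s : Finset ι) {β : ι → Torus1}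
    {p : ι → ℕ → Torus1} (hp : ∀ i ∈ s, IsPhasePoly d (β i) (p i)) :
    IsPhasePoly d (∑ i ∈ s, β i) (fun n => ∑ i ∈ s, p i n) := by
  classical
  induction s using Finset.induction_on with
  | empty => simpa using IsPhasePoly.zero d
  | insert a s ha ih =>
    simp only [sum_insert ha]
    exact (hp a (mem_insert_self a s)).add (ih fun i hi => hp i (mem_insert_of_mem hi))

lemma coeff_taylor_of_natDegree_le {Q : ℤ[X]} {d : ℕ} (hQ : Q.natDegree ≤ d + 1) (r : ℤ) :
    (taylor r Q).coeff d = Q.coeff d + (d + 1) * Q.coeff (d + 1) * r := by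
  have hdeg : (hasseDeriv d Q).natDegree < 2 :=
    (natDegree_hasseDeriv_le Q d).trans_lt (by omega)
  rw [taylor_coeff, eval_eq_sum_range' hdeg, sum_range_succ, sum_range_one, hasseDeriv_coeff,
    hasseDeriv_coeff]
  simp [add_comm 1 d]

lemma isPhasePoly_eval_smul (a : Torus1) {d : ℕ} {Q : ℤ[X]} (hQ : Q.natDegree ≤ d) :
    IsPhasePoly d ((d.factorial * Q.coeff d : ℤ) • a) (fun n => Q.eval (n : ℤ) • a) := by
  induction d generalizing Q with
  | zero =>
    intro n
    rw [eq_C_of_natDegree_le_zero hQ]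
    simp
  | succ d ih =>
    intro i j
    have htop : ∀ r : ℤ, (taylor r Q).coeff (d + 1) = Q.coeff (d + 1) := by
      intro r
      rw [coeff_taylor_of_natDegree_le (hQ.trans (by omega)),
        coeff_eq_zero_of_natDegree_lt (Nat.lt_succ_of_le hQ)]
      simp
    have hdeg : (taylor (i : ℤ) Q - taylor (j : ℤ) Q).natDegree ≤ d := by
      rw [natDegree_le_iff_coeff_eq_zero]
      intro m hm
      rcases (Nat.succ_le_of_lt hm).eq_or_lt with rfl | hm'
      · rw [coeff_sub, htop, htop, sub_self]
      · rw [coeff_sub, coeff_eq_zero_of_natDegree_lt, coeff_eq_zero_of_natDegree_lt, sub_self] <;>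
          rw [natDegree_taylor] <;> omega
    have := ih hdeg
    convert this using 1
    · rw [coeff_sub, coeff_taylor_of_natDegree_le hQ, coeff_taylor_of_natDegree_le hQ, smul_smul,
        Nat.factorial_succ]
      congr 1
      push_cast
      ring
    · funext n
      simp [eval_sub, taylor_eval, sub_smul]

/-- A polynomial `∑ n ^ e • a e` whose coefficients vanish beyond index `d`
has constant `d`-th difference `d! • a d`. -/
lemma isPhasePoly_sum_pow_smul {D : ℕ} (a : Fin (D + 1) → Torus1) (d : Fin (D + 1))
    (ha : ∀ e, d < e → a e = 0) :
    IsPhasePoly d ((d : ℕ).factorial • a d) (fun n => ∑ e : Fin (D + 1), ((n : ℤ) ^ (e : ℕ)) • a e) := by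
  classical
  have h : ∀ e ∈ (univ : Finset (Fin (D + 1))),
      IsPhasePoly d (if e = d then (d : ℕ).factorial • a d else 0)
        (fun n => ((n : ℤ) ^ (e : ℕ)) • a e) := by
    intro e _
    rcases lt_or_ge d e with hde | hde
    · rw [if_neg hde.ne', ha e hde]
      simpa using IsPhasePoly.zero d
    · have := isPhasePoly_eval_smul (a e) (d := d) (Q := X ^ (e : ℕ))
        (by rw [natDegree_X_pow]; exact hde)
      convert this using 1
      · rw [coeff_X_pow]
        by_cases hed : e = d
        · subst hed
          simp
        · have : (d : ℕ) ≠ e := fun hh => hed (Fin.ext hh.symm)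
          simp [hed, this]
      · simp
  simpa using IsPhasePoly.sum univ h

/-- Qualitative Weyl inequality, linear case. -/
lemma eventually_norm_avg_linear_le {β : Torus1} (hβ : β ≠ 0) {p : ℕ → Torus1}
    (hp : IsPhasePoly 1 β p) {δ : ℝ} (hδ : 0 < δ) :
    ∀ᶠ M : ℕ in atTop, ‖avg M (fun n => torusChar (p n))‖ ≤ δ := by
  have hc : 0 < ‖torusChar β - 1‖ := by
    rw [norm_pos_iff, sub_ne_zero]
    exact fun h => hβ (torusChar_eq_one_iff.1 h)
  have hshift : ∀ n, torusChar (p (n + 1)) = torusChar β * torusChar (p n) := by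
    intro n
    have := hp 1 0 n
    rw [← torusChar_add]
    congr 1
    simpa [sub_eq_iff_eq_add] using this
  have hlim : Tendsto (fun M : ℕ => 2 * ((1 : ℕ) : ℝ) / (M : ℝ)) atTop (𝓝 0) :=
    tendsto_const_div_atTop_nhds_zero_nat _
  filter_upwards [hlim.eventually_le_const (mul_pos hc hδ)] with M hM
  have := norm_avg_shift_sub_avg_le (M := M) (f := fun n => torusChar (p n))
    (fun n => (norm_torusChar _).le) 1
  simp only [hshift] at this
  rw [avg_mul_left, ← sub_one_mul, norm_mul] at this
  exact le_of_mul_le_mul_left (this.trans hM) hc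

lemma norm_avg_sq_le (M : ℕ) (f : ℕ → ℂ) :
    ‖avg M f‖ ^ 2 ≤ (M : ℝ)⁻¹ * ∑ n ∈ range M, ‖f n‖ ^ 2 := by
  rcases Nat.eq_zero_or_pos M with rfl | hM
  · simp [avg]
  have hM' : (0 : ℝ) < M := by exact_mod_cast hM
  rw [avg, norm_mul, norm_inv, Complex.norm_natCast, mul_pow, pow_two (M : ℝ)⁻¹, mul_assoc]
  gcongr
  rw [inv_mul_le_iff₀ hM']
  calc ‖∑ n ∈ range M, f n‖ ^ 2 ≤ (∑ n ∈ range M, ‖f n‖) ^ 2 := by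
        gcongr
        exact norm_sum_le _ _
    _ ≤ M * ∑ n ∈ range M, ‖f n‖ ^ 2 := by
        simpa using sq_sum_le_card_mul_sum_sq (s := range M) (f := fun n => ‖f n‖)

/-- Qualitative Weyl inequality: polynomial phases of positive degree whose top difference is not
a torsion point of small order have small exponential sums. -/
theorem exists_forall_isPhasePoly_eventually_norm_avg_le (d : ℕ) {δ : ℝ} (hδ : 0 < δ) :
    ∃ Q : ℕ, 0 < Q ∧ ∀ (β : Torus1) (p : ℕ → Torus1), IsPhasePoly (d + 1) β p →
      (∀ q : ℕ, 0 < q → q ≤ Q → q • β ≠ 0) →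
      ∀ᶠ M : ℕ in atTop, ‖avg M (fun n => torusChar (p n))‖ ≤ δ := by
  induction d generalizing δ with
  | zero =>
    refine ⟨1, one_pos, fun β p hp hβ => eventually_norm_avg_linear_le ?_ hp hδ⟩
    simpa using hβ 1 one_pos le_rfl
  | succ d ih =>
    obtain ⟨Q, hQ, hweyl⟩ := ih (δ := δ ^ 2 / 8) (by positivity)
    obtain ⟨H, hH⟩ := exists_nat_gt (8 / δ ^ 2)
    have hH0 : (0 : ℝ) < H := lt_trans (by positivity) hH
    have hHpos : 0 < H := by exact_mod_cast hH0
    have hHinv : (H : ℝ)⁻¹ ≤ δ ^ 2 / 8 := by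
      rw [inv_le_comm₀ hH0 (by positivity), inv_div]
      exact hH.le
    refine ⟨H * Q, Nat.mul_pos hHpos hQ, fun β p hp hβ => ?_⟩
    have hcorr : ∀ i ∈ range H, ∀ j ∈ range H, ∀ᶠ M : ℕ in atTop, i ≠ j →
        ‖avg M (fun n => torusChar (p (n + i) - p (n + j)))‖ ≤ δ ^ 2 / 8 := by
      intro i hi j hj
      by_cases hij : i = j
      · exact Eventually.of_forall fun M h => absurd hij h
      refine (hweyl _ _ (hp i j) fun q hq hqQ hzero => ?_).mono fun M hM _ => hM
      have hi := mem_range.1 hi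
      have hj := mem_range.1 hj
      refine hβ (((i : ℤ) - j).natAbs * q) (Nat.mul_pos (by omega) hq)
        (Nat.mul_le_mul (by omega) hqQ) ?_
      rw [mul_comm, mul_smul]
      rcases Int.natAbs_eq ((i : ℤ) - j) with h | h <;> rw [h] at hzero
      · rwa [natCast_zsmul] at hzero
      · rwa [neg_smul, natCast_zsmul, smul_neg, neg_eq_zero] at hzero
    have hcorr' : ∀ᶠ M : ℕ in atTop, ∀ i ∈ range H, ∀ j ∈ range H, i ≠ j →
        ‖avg M (fun n => torusChar (p (n + i) - p (n + j)))‖ ≤ δ ^ 2 / 8 := by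
      rw [eventually_all_finset]
      intro i hi
      rw [eventually_all_finset]
      exact hcorr i hi
    have hlim : Tendsto (fun M : ℕ => 2 * (H : ℝ) / (M : ℝ)) atTop (𝓝 0) :=
      tendsto_const_div_atTop_nhds_zero_nat _
    filter_upwards [hcorr', hlim.eventually_le_const (half_pos hδ)] with M hM hMH
    set f : ℕ → ℂ := fun n => torusChar (p n) with hf
    set g : ℕ → ℂ := fun n => (H : ℂ)⁻¹ * ∑ i ∈ range H, f (n + i) with hg
    have hsq : ‖avg M g‖ ^ 2 ≤ (δ / 2) ^ 2 :=
      calc ‖avg M g‖ ^ 2 ≤ _ := norm_avg_sq_le M g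
        _ ≤ (H : ℝ)⁻¹ + δ ^ 2 / 8 :=
          avg_normSq_sum_le hHpos (fun i n => p (n + i)) (by positivity)
            fun i hi j hj hij => hM i (mem_range.2 hi) j (mem_range.2 hj) hij
        _ ≤ (δ / 2) ^ 2 := by linarith
    have hgle : ‖avg M g‖ ≤ δ / 2 := le_of_sq_le_sq hsq (by positivity)
    have hdiff : ‖avg M g - avg M f‖ ≤ δ / 2 := by
      have : avg M g - avg M f
          = (H : ℂ)⁻¹ * ∑ i ∈ range H, (avg M (fun n => f (n + i)) - avg M f) := by
        rw [hg, avg_mul_left, avg_sum, sum_sub_distrib]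
        have : (H : ℂ) ≠ 0 := by exact_mod_cast hHpos.ne'
        simp [mul_sub, this]
      rw [this, norm_mul, norm_inv, Complex.norm_natCast, inv_mul_le_iff₀ hH0]
      calc _ ≤ ∑ i ∈ range H, ‖avg M (fun n => f (n + i)) - avg M f‖ := norm_sum_le _ _
        _ ≤ ∑ i ∈ range H, δ / 2 := by
            refine sum_le_sum fun i hi => ?_
            refine (norm_avg_shift_sub_avg_le (fun n => (norm_torusChar _).le) i).trans ?_
            refine le_trans ?_ hMH
            have : (i : ℝ) ≤ H := by exact_mod_cast (mem_range.1 hi).le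
            gcongr
        _ = H * (δ / 2) := by simp
    calc ‖avg M f‖ = ‖avg M g - (avg M g - avg M f)‖ := by rw [sub_sub_cancel]
      _ ≤ δ / 2 + δ / 2 := (norm_sub_le _ _).trans (add_le_add hgle hdiff)
      _ = δ := add_halves δ

end WeylSums

section Density

open Finset MeasureTheory

/-- The pairing `w · x` of an integer vector with a point of the torus. -/
noncomputable def torusDot {ι : Type*} [Fintype ι] (w : ι → ℤ) (x : ι → Torus1) : Torus1 :=
  ∑ j, w j • x j

lemma torusDot_sub {ι : Type*} [Fintype ι] (w : ι → ℤ) (x y : ι → Torus1) :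
    torusDot w (x - y) = torusDot w x - torusDot w y := by
  simp [torusDot, smul_sub]

lemma torusDot_add {ι : Type*} [Fintype ι] (w : ι → ℤ) (x y : ι → Torus1) :
    torusDot w (x + y) = torusDot w x + torusDot w y := by
  simp [torusDot, smul_add, sum_add_distrib]

lemma torusDot_smul {ι : Type*} [Fintype ι] (q : ℤ) (w : ι → ℤ) (x : ι → Torus1) :
    torusDot (q • w) x = q • torusDot w x := by
  simp [torusDot, smul_sum, mul_smul]

lemma mFourier_eq_torusChar {l : ℕ} (v : Fin l → ℤ) (y : Fin l → Torus1) :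
    UnitAddTorus.mFourier v y = torusChar (torusDot v y) := by
  rw [torusDot, torusChar_sum]
  rfl

lemma exists_torusDot_ne_zero {l : ℕ} {v : Fin l → ℤ} (hv : v ≠ 0) :
    ∃ s : Fin l → Torus1, torusDot v s ≠ 0 := by
  obtain ⟨j, hj⟩ := Function.ne_iff.1 hv
  have hj' : (v j : ℝ) ≠ 0 := by exact_mod_cast hj
  refine ⟨Pi.single j (((2 * (v j : ℝ))⁻¹ : ℝ) : Torus1), ?_⟩
  have : torusDot v (Pi.single j (((2 * (v j : ℝ))⁻¹ : ℝ) : Torus1))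
      = (((1 / 2 : ℝ)) : Torus1) := by
    rw [torusDot, sum_eq_single j]
    · rw [Pi.single_eq_same, ← AddCircle.coe_zsmul, zsmul_eq_mul]
      congr 1
      field_simp
    · intro b _ hb
      simp [hb]
    · simp
  rw [this]
  intro h
  obtain ⟨n, hn⟩ := AddCircle.coe_eq_zero_iff (1 : ℝ) |>.1 h
  have h2 : ((2 * n : ℤ) : ℝ) = (1 : ℤ) := by
    push_cast
    simp at hn
    linarith
  have h3 : 2 * n = 1 := by exact_mod_cast h2
  omega

/-- The normalised Haar measure on the torus. -/
noncomputable def torusHaar (l : ℕ) : Measure (Fin l → Torus1) :=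
  Measure.pi fun _ => AddCircle.haarAddCircle

instance (l : ℕ) : IsProbabilityMeasure (torusHaar l) := by
  unfold torusHaar; infer_instance

instance (l : ℕ) : (torusHaar l).IsAddHaarMeasure := by
  unfold torusHaar; infer_instance

lemma integral_mFourier {l : ℕ} {v : Fin l → ℤ} (hv : v ≠ 0) :
    ∫ y, UnitAddTorus.mFourier v y ∂(torusHaar l) = 0 := by
  obtain ⟨s, hs⟩ := exists_torusDot_ne_zero hv
  have h := integral_add_right_eq_self (μ := torusHaar l) (fun y => UnitAddTorus.mFourier v y) s
  simp only [mFourier_eq_torusChar, torusDot_add, torusChar_add] at h ⊢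
  rw [integral_mul_const] at h
  have h1 : torusChar (torusDot v s) ≠ 1 := fun h => hs (torusChar_eq_one_iff.1 h)
  by_contra hI
  exact h1 (mul_left_cancel₀ hI (by rw [h, mul_one]))

/-- Finite Fourier criterion for `ε`-density: a finite family of points of the torus whose
normalised exponential sums at finitely many nonzero frequencies are small is `ε`-dense. -/
theorem exists_finset_forall_small_imp_dense (l : ℕ) {ε : ℝ} (hε : 0 < ε) :
    ∃ (S : Finset (Fin l → ℤ)) (σ : ℝ), 0 ∉ S ∧ 0 < σ ∧ ∀ k : ℕ, 0 < k →
      ∀ y : ℕ → Fin l → Torus1,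
      (∀ v ∈ S, ‖(k : ℂ)⁻¹ * ∑ i ∈ range k, torusChar (torusDot v (y i))‖ ≤ σ) →
      ∀ t : Fin l → Torus1, ∃ i < k, ∀ j, dist (y i j) (t j) ≤ ε := by
  classical
  let φ : (Fin l → Torus1) → ℝ := fun y => max 0 (ε - ‖y‖)
  have hφc : Continuous φ := by fun_prop
  have hφ0 : ∀ y, 0 ≤ φ y := fun y => le_max_left _ _
  set I : ℝ := ∫ y, φ y ∂(torusHaar l) with hI
  have hIpos : 0 < I :=
    hφc.integral_pos_of_hasCompactSupport_nonneg_nonzero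
      (HasCompactSupport.of_compactSpace φ) hφ0 (x := 0) (by simp [φ, hε.le, hε.ne'])
  let Φ : C(UnitAddTorus (Fin l), ℂ) := ⟨fun y => (φ y : ℂ), by fun_prop⟩
  have hΦmem : Φ ∈ (Submodule.span ℂ
      (Set.range <| UnitAddTorus.mFourier (d := Fin l))).topologicalClosure := by
    rw [UnitAddTorus.span_mFourier_closure_eq_top]
    trivial
  obtain ⟨P, hP, hdist⟩ := Metric.mem_closure_iff.1 hΦmem (I / 4) (by positivity)
  obtain ⟨c, rfl⟩ := Finsupp.mem_span_range_iff_exists_finsupp.1 hP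
  set P : C(UnitAddTorus (Fin l), ℂ) := c.sum fun i a => a • UnitAddTorus.mFourier i with hPdef
  have hPapply : ∀ y, P y = ∑ v ∈ c.support, c v * torusChar (torusDot v y) := by
    intro y
    simp [hPdef, Finsupp.sum, ContinuousMap.sum_apply, mFourier_eq_torusChar]
  have hclose : ∀ y, ‖(φ y : ℂ) - P y‖ ≤ I / 4 := by
    intro y
    rw [← dist_eq_norm]
    exact (ContinuousMap.dist_apply_le_dist (f := Φ) (g := P) y).trans hdist.le
  have hintegrable : ∀ f : C(UnitAddTorus (Fin l), ℂ), Integrable f (torusHaar l) := fun f =>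
    f.continuous.integrable_of_hasCompactSupport (HasCompactSupport.of_compactSpace f)
  have hPint : ∫ y, P y ∂(torusHaar l) = c 0 := by
    have : ∀ y, P y = ∑ v ∈ c.support, c v * UnitAddTorus.mFourier v y := by
      simpa only [mFourier_eq_torusChar] using hPapply
    simp only [this]
    rw [integral_finsetSum _ fun v _ => (hintegrable _).const_mul _]
    simp only [integral_const_mul]
    rw [sum_eq_single 0]
    · simp [UnitAddTorus.mFourier_zero]
    · intro v _ hv
      rw [integral_mFourier hv, mul_zero]
    · intro h
      simp [Finsupp.notMem_support_iff.1 h]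
  have hc0 : I - ‖c 0‖ ≤ I / 4 := by
    have h1 : ‖∫ y, ((φ y : ℂ) - P y) ∂(torusHaar l)‖ ≤ I / 4 := by
      simpa using norm_integral_le_of_norm_le_const (μ := torusHaar l)
        (Filter.Eventually.of_forall hclose)
    rw [integral_sub (f := fun y => (φ y : ℂ)) (hintegrable Φ) (hintegrable P), hPint,
      integral_complex_ofReal, ← hI] at h1
    have h2 := norm_sub_norm_le (I : ℂ) (c 0)
    rw [Complex.norm_real, Real.norm_of_nonneg hIpos.le] at h2
    linarith
  set C : ℝ := ∑ v ∈ c.support.erase 0, ‖c v‖ with hC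
  have hC0 : 0 ≤ C := sum_nonneg fun v _ => norm_nonneg _
  refine ⟨c.support.erase 0, I / (4 * (C + 1)), by simp, by positivity, fun k hk y hy t => ?_⟩
  by_contra! hfar
  have hk' : (0 : ℝ) < k := by exact_mod_cast hk
  have hφzero : ∀ i < k, φ (y i - t) = 0 := by
    intro i hi
    obtain ⟨j, hj⟩ := hfar i hi
    refine max_eq_left ?_
    have := norm_le_pi_norm (y i - t) j
    rw [dist_eq_norm] at hj
    rw [Pi.sub_apply] at this
    linarith
  have hPsmall : ‖(k : ℂ)⁻¹ * ∑ i ∈ range k, P (y i - t)‖ ≤ I / 4 := by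
    rw [norm_mul, norm_inv, Complex.norm_natCast, inv_mul_le_iff₀ hk']
    calc _ ≤ ∑ i ∈ range k, ‖P (y i - t)‖ := norm_sum_le _ _
      _ ≤ ∑ i ∈ range k, I / 4 := by
          refine sum_le_sum fun i hi => ?_
          simpa [hφzero i (mem_range.1 hi)] using hclose (y i - t)
      _ = k * (I / 4) := by simp
  set E : (Fin l → ℤ) → ℂ := fun v =>
    (k : ℂ)⁻¹ * ∑ i ∈ range k, torusChar (torusDot v (y i)) with hE
  have hPexp : (k : ℂ)⁻¹ * ∑ i ∈ range k, P (y i - t)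
      = ∑ v ∈ c.support, c v * torusChar (-torusDot v t) * E v := by
    simp only [hPapply, hE]
    rw [sum_comm, mul_sum]
    refine sum_congr rfl fun v _ => ?_
    rw [mul_left_comm (c v * _)]
    congr 1
    rw [mul_sum]
    refine sum_congr rfl fun i _ => ?_
    rw [torusDot_sub, sub_eq_add_neg, torusChar_add]
    ring
  have hsplit : ∑ v ∈ c.support, c v * torusChar (-torusDot v t) * E v
      = c 0 + ∑ v ∈ c.support.erase 0, c v * torusChar (-torusDot v t) * E v := by
    have hE0 : c 0 * torusChar (-torusDot 0 t) * E 0 = c 0 := by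
      have : (k : ℂ) ≠ 0 := by exact_mod_cast hk.ne'
      simp [hE, torusDot, this]
    by_cases h0 : 0 ∈ c.support
    · rw [← add_sum_erase _ _ h0, hE0]
    · rw [erase_eq_of_notMem h0, Finsupp.notMem_support_iff.1 h0, zero_add]
  have hrest : ‖∑ v ∈ c.support.erase 0, c v * torusChar (-torusDot v t) * E v‖ ≤ I / 4 :=
    calc _ ≤ ∑ v ∈ c.support.erase 0, ‖c v‖ * (I / (4 * (C + 1))) := by
          refine (norm_sum_le _ _).trans (sum_le_sum fun v hv => ?_)
          rw [norm_mul, norm_mul, norm_torusChar, mul_one]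
          exact mul_le_mul_of_nonneg_left (hy v hv) (norm_nonneg _)
      _ = C * (I / (4 * (C + 1))) := by rw [← sum_mul]
      _ ≤ (C + 1) * (I / (4 * (C + 1))) := by gcongr; linarith
      _ = I / 4 := by field_simp
  rw [hPexp, hsplit] at hPsmall
  have := norm_sub_le (c 0 + ∑ v ∈ c.support.erase 0, c v * torusChar (-torusDot v t) * E v)
    (∑ v ∈ c.support.erase 0, c v * torusChar (-torusDot v t) * E v)
  rw [add_sub_cancel_right] at this
  linarith

end Density

section Assembly

open Filter Finset

lemma coe_rep (x : Torus1) : ((rep x : ℝ) : Torus1) = x :=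
  haveI : Fact ((0 : ℝ) < 1) := ⟨zero_lt_one⟩
  AddCircle.coe_equivIco

lemma rep_mem_Ico (x : Torus1) : rep x ∈ Set.Ico (0 : ℝ) 1 := by
  have : Fact ((0 : ℝ) < 1) := ⟨zero_lt_one⟩
  simpa [rep] using ((AddCircle.equivIco 1 0) x).2

lemma coe_sum_mul_rep_sub {N : ℕ} (w : Fin N → ℤ) (y z : Fin N → Torus1) :
    ((∑ i, (w i : ℝ) * (rep (y i) - rep (z i)) : ℝ) : Torus1) = torusDot w y - torusDot w z := by
  have h : ∀ s : Finset (Fin N), ((∑ i ∈ s, (w i : ℝ) * (rep (y i) - rep (z i)) : ℝ) : Torus1)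
      = ∑ i ∈ s, w i • (y i - z i) := by
    intro s
    induction s using Finset.induction_on with
    | empty => simp
    | insert a s ha ih =>
      rw [sum_insert ha, sum_insert ha, AddCircle.coe_add, ih, ← zsmul_eq_mul,
        AddCircle.coe_zsmul, AddCircle.coe_sub, coe_rep, coe_rep]
  rw [h, torusDot, torusDot, ← sum_sub_distrib]
  exact sum_congr rfl fun i _ => smul_sub _ _ _

/-- If each affine integer relation between representatives holds for finitely many points only,
then each character has finite fibres on `X`. -/
lemma finite_setOf_torusDot_eq {N : ℕ} {X : Set (Fin N → Torus1)} {w : Fin N → ℤ}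
    {z : Fin N → Torus1}
    (h : ∀ J : ℤ, {y ∈ X | (∑ i, (w i : ℝ) * (rep (y i) - rep (z i))) = (J : ℝ)}.Finite) :
    {y ∈ X | torusDot w y = torusDot w z}.Finite := by
  set C : ℤ := ∑ i, |w i| with hC
  refine ((Set.finite_Icc (-C) C).biUnion fun J _ => h J).subset ?_
  rintro y ⟨hyX, hy⟩
  have h0 := coe_sum_mul_rep_sub w y z
  rw [hy, sub_self] at h0
  obtain ⟨J, hJ⟩ := (AddCircle.coe_eq_zero_iff (1 : ℝ)).1 h0
  rw [zsmul_eq_mul, mul_one] at hJ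
  have hbound : |(J : ℝ)| ≤ (C : ℤ) := by
    rw [hJ, hC]
    push_cast
    refine (abs_sum_le_sum_abs _ _).trans (sum_le_sum fun i _ => ?_)
    rw [abs_mul]
    have h1 := rep_mem_Ico (y i)
    have h2 := rep_mem_Ico (z i)
    refine mul_le_of_le_one_right (abs_nonneg _) (abs_le.2 ⟨?_, ?_⟩) <;>
      linarith [h1.1, h1.2, h2.1, h2.2]
  have hbound' : |J| ≤ C := by exact_mod_cast hbound
  simp only [Set.mem_iUnion]
  exact ⟨J, abs_le.1 hbound', hyX, hJ.symm⟩

/-- An infinite set on which finitely many functions have finite fibres contains a sequence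
on which all of these functions are injective. -/
lemma exists_seq_pairwise_ne {α β ι : Type*} {X : Set α} (hX : X.Infinite) (W : Finset ι)
    (f : ι → α → β) (h : ∀ w ∈ W, ∀ z ∈ X, {y ∈ X | f w y = f w z}.Finite) :
    ∃ x : ℕ → α, (∀ n, x n ∈ X) ∧ ∀ i j, i ≠ j → ∀ w ∈ W, f w (x i) ≠ f w (x j) := by
  obtain ⟨x, hxX, hx⟩ := exists_seq_of_forall_finset_exists (· ∈ X)
    (fun a b => ∀ w ∈ W, f w a ≠ f w b) (by
      intro s hs
      have hfin : (⋃ z ∈ s, ⋃ w ∈ W, {y ∈ X | f w y = f w z}).Finite :=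
        s.finite_toSet.biUnion fun z hz => W.finite_toSet.biUnion fun w hw => h w hw z (hs z hz)
      obtain ⟨y, hyX, hy⟩ := hX.exists_notMem_finite hfin
      refine ⟨y, hyX, fun z hz w hw heq => hy ?_⟩
      simp only [Set.mem_iUnion]
      exact ⟨z, hz, w, hw, hyX, heq.symm⟩)
  refine ⟨x, hxX, fun i j hij w hw => ?_⟩
  rcases lt_or_gt_of_ne hij with hij | hij
  · exact hx i j hij w hw
  · exact (hx j i hij w hw).symm

lemma torusDot_torusAct_evalMat {L N D : ℕ} (B : Fin (D + 1) → Matrix (Fin L) (Fin N) ℤ)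
    (v : Fin L → ℤ) (n : ℤ) (x : Fin N → Torus1) :
    torusDot v (torusAct (evalMat B n) x)
      = ∑ d : Fin (D + 1), (n ^ (d : ℕ)) • torusDot (v ᵥ* B d) x := by
  have hcomp : torusDot v (torusAct (evalMat B n) x) = torusDot (v ᵥ* evalMat B n) x := by
    simp only [torusDot, torusAct, Matrix.vecMul, dotProduct, smul_sum, sum_smul, mul_smul]
    exact sum_comm
  rw [hcomp]
  have hvec : v ᵥ* evalMat B n = ∑ d : Fin (D + 1), (n ^ (d : ℕ)) • (v ᵥ* B d) := by
    simp only [evalMat, Matrix.vecMul_sum, Matrix.vecMul_smul]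
  rw [hvec]
  simp only [← torusDot_smul]
  simp only [torusDot, Finset.sum_apply, sum_smul]
  exact sum_comm

lemma exists_top_vecMul_ne_zero {L N D : ℕ} {B : Fin (D + 1) → Matrix (Fin L) (Fin N) ℤ}
    (hB : LinearIndependent ℚ (starRows B)) {v : Fin L → ℤ} (hv : v ≠ 0) :
    ∃ d : Fin (D + 1), d ≠ 0 ∧ v ᵥ* B d ≠ 0 ∧ ∀ e, d < e → v ᵥ* B e = 0 := by
  classical
  have hex : ∃ d : Fin (D + 1), d ≠ 0 ∧ v ᵥ* B d ≠ 0 := by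
    by_contra! hall
    refine hv (funext fun i => ?_)
    have := Fintype.linearIndependent_iff.1 hB (fun i => (v i : ℚ)) (by
      funext p
      have h := congrFun (hall p.1.succ (Fin.succ_ne_zero _)) p.2
      simp only [Matrix.vecMul, dotProduct, Pi.zero_apply] at h
      simp only [Finset.sum_apply, Pi.smul_apply, starRows, smul_eq_mul, Pi.zero_apply]
      exact_mod_cast h) i
    exact_mod_cast this
  obtain ⟨d₀, hd₀⟩ := hex
  obtain ⟨d, hd, hmax⟩ := (univ.filter fun d : Fin (D + 1) => v ᵥ* B d ≠ 0).exists_max_image id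
    ⟨d₀, by simpa using hd₀.2⟩
  simp only [mem_filter, mem_univ, true_and, id] at hd hmax
  refine ⟨d, ?_, hd, fun e he => ?_⟩
  · rintro rfl
    exact hd₀.1 (Fin.le_zero_iff.1 (hmax d₀ hd₀.2))
  · by_contra hne
    exact absurd (hmax e hne) (not_le.2 he)

/-- If nonnegative sequences have small averages in total, some common term is small. -/
lemma exists_forall_le_of_sum_avg_lt {ι : Type*} {S : Finset ι} {M : ℕ} {g : ι → ℕ → ℝ} {τ : ℝ}
    (hg : ∀ v ∈ S, ∀ n, 0 ≤ g v n)
    (h : ∑ v ∈ S, (M : ℝ)⁻¹ * ∑ n ∈ range M, g v n < τ) (hM : 0 < M) :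
    ∃ n, ∀ v ∈ S, g v n ≤ τ := by
  by_contra! hno
  have hM' : (0 : ℝ) < M := by exact_mod_cast hM
  have h1 : ∀ n ∈ range M, τ ≤ ∑ v ∈ S, g v n := by
    intro n _
    obtain ⟨v, hv, hlt⟩ := hno n
    exact hlt.le.trans (single_le_sum (f := fun v => g v n) (fun u hu => hg u hu n) hv)
  have h2 := sum_le_sum h1
  rw [sum_comm, sum_const, card_range, nsmul_eq_mul] at h2
  rw [← mul_sum, inv_mul_lt_iff₀ hM'] at h
  linarith

/-- If every nonzero character has finite fibres on the infinite set `X` and the rows of the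
non-constant part of `B` are independent, some dilation `B(r) X` is `ε`-dense. -/
theorem exists_epsDense_of_finite_fibres {L N D : ℕ} {ε : ℝ} (hε : 0 < ε)
    {B : Fin (D + 1) → Matrix (Fin L) (Fin N) ℤ} (hB : LinearIndependent ℚ (starRows B))
    {X : Set (Fin N → Torus1)} (hX : X.Infinite)
    (hfib : ∀ w : Fin N → ℤ, w ≠ 0 → ∀ z ∈ X, {y ∈ X | torusDot w y = torusDot w z}.Finite) :
    ∃ r : ℤ, EpsDense (torusAct (evalMat B r) '' X) ε := by
  classical
  obtain ⟨S, σ, hS0, hσ, hdense⟩ := exists_finset_forall_small_imp_dense L hε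
  set δ : ℝ := σ ^ 2 / (4 * (#S + 1)) with hδdef
  have hδ : 0 < δ := by positivity
  choose Q hQpos hQ using fun d => exists_forall_isPhasePoly_eventually_norm_avg_le d hδ
  have htop : ∀ v : Fin L → ℤ, v ∈ S →
      ∃ d : Fin (D + 1), d ≠ 0 ∧ v ᵥ* B d ≠ 0 ∧ ∀ e, d < e → v ᵥ* B e = 0 :=
    fun v hv => exists_top_vecMul_ne_zero hB fun h => hS0 (h ▸ hv)
  choose! d hd0 hdB hdtop using htop
  let W : Finset (Fin N → ℤ) := S.biUnion fun v =>
    (Icc 1 (Q ((d v : ℕ) - 1))).image fun q => ((q * (d v : ℕ).factorial : ℕ) : ℤ) • (v ᵥ* B (d v))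
  have hW0 : ∀ w ∈ W, w ≠ 0 := by
    intro w hw
    simp only [W, mem_biUnion, mem_image, mem_Icc] at hw
    obtain ⟨v, hv, q, ⟨hq, -⟩, rfl⟩ := hw
    refine smul_ne_zero ?_ (hdB v hv)
    exact_mod_cast (Nat.mul_pos hq (Nat.factorial_pos _)).ne'
  obtain ⟨x, hxX, hx⟩ := exists_seq_pairwise_ne hX W torusDot fun w hw => hfib w (hW0 w hw)
  obtain ⟨k, hk⟩ := exists_nat_gt δ⁻¹
  have hk' : (0 : ℝ) < k := (inv_pos.2 hδ).trans hk
  have hkpos : 0 < k := by exact_mod_cast hk'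
  have hkinv : (k : ℝ)⁻¹ ≤ δ := (inv_lt_of_inv_lt₀ hδ hk).le
  let p : (Fin L → ℤ) → ℕ → ℕ → Torus1 := fun v i n => torusDot v (torusAct (evalMat B n) (x i))
  have hcorr : ∀ v ∈ S, ∀ i ∈ range k, ∀ j ∈ range k, ∀ᶠ M : ℕ in atTop, i ≠ j →
      ‖avg M (fun n => torusChar (p v i n - p v j n))‖ ≤ δ := by
    intro v hv i _ j _
    by_cases hij : i = j
    · exact Eventually.of_forall fun M h => absurd hij h
    have hdpos : (d v : ℕ) - 1 + 1 = d v := by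
      have : (d v : ℕ) ≠ 0 := fun h => hd0 v hv (Fin.ext h)
      omega
    have hphase := isPhasePoly_sum_pow_smul (fun e => torusDot (v ᵥ* B e) (x i - x j)) (d v)
      fun e he => by simp [hdtop v hv e he, torusDot]
    rw [← hdpos] at hphase
    refine (hQ _ _ _ hphase fun q hq hqQ hzero => ?_).mono fun M hM _ => ?_
    · have hmem : ((q * (d v : ℕ).factorial : ℕ) : ℤ) • (v ᵥ* B (d v)) ∈ W :=
        mem_biUnion.2 ⟨v, hv, mem_image.2 ⟨q, mem_Icc.2 ⟨hq, hqQ⟩, rfl⟩⟩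
      refine hx i j hij _ hmem (sub_eq_zero.1 ?_)
      rw [← torusDot_sub, torusDot_smul, natCast_zsmul, mul_smul]
      rwa [hdpos] at hzero
    · convert hM using 5 with n
      simp only [p, ← torusDot_sub, torusDot_torusAct_evalMat, ← sum_sub_distrib, ← smul_sub]
  have hcorr' : ∀ᶠ M : ℕ in atTop, ∀ v ∈ S, ∀ i ∈ range k, ∀ j ∈ range k, i ≠ j →
      ‖avg M (fun n => torusChar (p v i n - p v j n))‖ ≤ δ := by
    simp only [eventually_all_finset]
    exact hcorr
  obtain ⟨M, hM, hMpos⟩ := (hcorr'.and (eventually_gt_atTop 0)).exists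
  obtain ⟨n, hn⟩ := exists_forall_le_of_sum_avg_lt (S := S) (M := M) (τ := σ ^ 2)
    (g := fun v n => ‖(k : ℂ)⁻¹ * ∑ i ∈ range k, torusChar (p v i n)‖ ^ 2)
    (fun v _ n => by positivity) (by
      calc _ ≤ ∑ v ∈ S, (δ + δ) := by
            refine sum_le_sum fun v hv => ?_
            refine (avg_normSq_sum_le hkpos (p v) hδ.le fun i hi j hj hij =>
              hM v hv i (mem_range.2 hi) j (mem_range.2 hj) hij).trans ?_
            gcongr
        _ = σ ^ 2 * (2 * #S / (4 * (#S + 1))) := by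
            rw [sum_const, nsmul_eq_mul, hδdef]
            ring
        _ < σ ^ 2 * 1 := by
            gcongr
            rw [div_lt_one (by positivity)]
            have : (0 : ℝ) ≤ #S := by positivity
            linarith
        _ = σ ^ 2 := mul_one _) hMpos
  refine ⟨n, fun t => ?_⟩
  obtain ⟨i, -, hi⟩ := hdense k hkpos (fun i => torusAct (evalMat B n) (x i))
    (fun v hv => le_of_sq_le_sq (hn v hv) hσ.le) t
  exact ⟨_, ⟨x i, hxX i, rfl⟩, hi⟩

end Assembly

/-- **Proposition 6.** If the rows of `B_*(x)` are `ℚ`-linearly independent and no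
dilation `B(r) X` of the infinite set `X ⊆ 𝕋^N` is `ε`-dense in `𝕋^ℓ`, then there are
`y₀ ∈ X`, an integer `J` and a nonzero `w ∈ ℤ^N` with `w·(y − y₀) = J` (as real
numbers, for representatives in `[0,1)^N`) for infinitely many `y ∈ X`. -/
theorem statement14 (l N D : ℕ) (hl : 0 < l) (hN : 0 < N) (hD : 0 < D)
    (ε : ℝ) (hε : 0 < ε)
    (B : Fin (D + 1) → Matrix (Fin l) (Fin N) ℤ)
    (hB : LinearIndependent ℚ (starRows B))
    (X : Set (Fin N → Torus1)) (hX : X.Infinite)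
    (hnd : ∀ r : ℤ, ¬ EpsDense (torusAct (evalMat B r) '' X) ε) :
    ∃ y₀ ∈ X, ∃ J : ℤ, ∃ w : Fin N → ℤ, w ≠ 0 ∧
      {y ∈ X | (∑ i, (w i : ℝ) * (rep (y i) - rep (y₀ i))) = (J : ℝ)}.Infinite := by
  by_contra! hcon
  obtain ⟨r, hr⟩ := exists_epsDense_of_finite_fibres hε hB hX fun w hw z hz =>
    finite_setOf_torusDot_eq fun J => by simpa using hcon z hz J w hw
  exact hnd r hr
end
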